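/- arXiv:1609.04586 — 3 statements merged into one kernel-verified Lean document; each statement's English description precedes it below -/
import Mathlib

section
/- Let F be a finite field and let M, K, W be mutually independent random vectors, uniformly distributed over F^t, F^Δ, F^Θ respectively. Let A, B, G be matrices over F with k rows and t, Δ, Θ columns respectively, and let C = AM + BK + GW ∈ F^k. Then the mutual information I(M;C) is either equal to 0 or at least log₂|F| ≥ 1. Consequently, if I(M;C) ≤ ε for some ε < 1, then I(M;C) = 0, i.e., M and C are independent (perfect secrecy holds). -/
open Finset

noncomputable section

/-- Sample space: the triple `(M, K, W)` of mutually independent uniform random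
vectors over `F^t × F^Δ × F^Θ`, modeled as the uniform distribution on this product. -/
abbrev SampleSpace (F : Type) (t Δ Θ : ℕ) : Type :=
  (Fin t → F) × (Fin Δ → F) × (Fin Θ → F)

/-- Joint pmf of `(M, C)` where `C = A M + B K + G W` and `(M,K,W)` is uniform on the
sample space. -/
def jointMC {F : Type} [Field F] [Fintype F] [DecidableEq F] {k t Δ Θ : ℕ}
    (A : Matrix (Fin k) (Fin t) F) (B : Matrix (Fin k) (Fin Δ) F)
    (G : Matrix (Fin k) (Fin Θ) F) (m : Fin t → F) (c : Fin k → F) : ℝ :=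
  ((univ.filter (fun ω : SampleSpace F t Δ Θ =>
      ω.1 = m ∧ A.mulVec ω.1 + B.mulVec ω.2.1 + G.mulVec ω.2.2 = c)).card : ℝ) /
    (Fintype.card (SampleSpace F t Δ Θ) : ℝ)

/-- Marginal pmf of `M`. -/
def pM {F : Type} [Field F] [Fintype F] [DecidableEq F] {k t Δ Θ : ℕ}
    (A : Matrix (Fin k) (Fin t) F) (B : Matrix (Fin k) (Fin Δ) F)
    (G : Matrix (Fin k) (Fin Θ) F) (m : Fin t → F) : ℝ :=
  ∑ c : Fin k → F, jointMC A B G m c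

/-- Marginal pmf of `C`. -/
def pC {F : Type} [Field F] [Fintype F] [DecidableEq F] {k t Δ Θ : ℕ}
    (A : Matrix (Fin k) (Fin t) F) (B : Matrix (Fin k) (Fin Δ) F)
    (G : Matrix (Fin k) (Fin Θ) F) (c : Fin k → F) : ℝ :=
  ∑ m : Fin t → F, jointMC A B G m c

/-- Mutual information `I(M;C)` in bits (terms with zero joint probability vanish,
since `0 · log₂(0/x) = 0` and `Real.logb 2 0 = 0`). -/
def miMC {F : Type} [Field F] [Fintype F] [DecidableEq F] {k t Δ Θ : ℕ}
    (A : Matrix (Fin k) (Fin t) F) (B : Matrix (Fin k) (Fin Δ) F)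
    (G : Matrix (Fin k) (Fin Θ) F) : ℝ :=
  ∑ m : Fin t → F, ∑ c : Fin k → F,
    jointMC A B G m c *
      Real.logb 2 (jointMC A B G m c / (pM A B G m * pC A B G c))

/-- The fibres of a linear map between finite modules are empty off the range and all of the
same size over it. -/
lemma LinearMap.card_fiber_mul_card_range {F X Y : Type*} [Ring F] [AddCommGroup X] [Module F X]
    [Fintype X] [AddCommGroup Y] [Module F Y] [DecidableEq Y] (f : X →ₗ[F] Y) (y : Y)
    [Decidable (y ∈ LinearMap.range f)] :
    #{x | f x = y} * Nat.card (LinearMap.range f) =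
      if y ∈ LinearMap.range f then Fintype.card X else 0 := by
  classical
  split_ifs with h
  · have h0 : #{x | f x = y} = #{x | f x = 0} :=
      AddMonoidHom.card_fiber_eq_of_mem_range f.toAddMonoidHom
        (by simpa using h) ⟨0, by simp⟩
    have hk : #{x | f x = 0} = Nat.card (LinearMap.ker f) := by
      rw [← Fintype.card_subtype, ← Nat.card_eq_fintype_card]
      rfl
    rw [h0, hk, ← Nat.card_congr f.quotKerEquivRange.toEquiv, ← Nat.card_eq_fintype_card,
      Submodule.card_eq_card_quotient_mul_card (LinearMap.ker f)]
  · have : #{x | f x = y} = 0 := by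
      rw [Finset.card_eq_zero, Finset.filter_eq_empty_iff]
      exact fun x _ hx => h ⟨x, hx⟩
    rw [this, zero_mul]

lemma one_le_logb_two_card (F : Type*) [Fintype F] [Nontrivial F] :
    1 ≤ Real.logb 2 (Fintype.card F) := by
  rw [Real.le_logb_iff_rpow_le one_lt_two (by exact_mod_cast Fintype.card_pos), Real.rpow_one]
  exact_mod_cast Fintype.one_lt_card (α := F)

/-- The key-and-noise part `(K, W) ↦ B K + G W` of the code, as a linear map. -/
def maskMap {F : Type} [Field F] {k Δ Θ : ℕ} (B : Matrix (Fin k) (Fin Δ) F)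
    (G : Matrix (Fin k) (Fin Θ) F) : ((Fin Δ → F) × (Fin Θ → F)) →ₗ[F] (Fin k → F) :=
  B.mulVecLin.coprod G.mulVecLin

/-- The encoder `(M, K, W) ↦ A M + B K + G W`, as a linear map. -/
def encoderMap {F : Type} [Field F] {k t Δ Θ : ℕ} (A : Matrix (Fin k) (Fin t) F)
    (B : Matrix (Fin k) (Fin Δ) F) (G : Matrix (Fin k) (Fin Θ) F) :
    SampleSpace F t Δ Θ →ₗ[F] (Fin k → F) :=
  A.mulVecLin.coprod (maskMap B G)

section LinearCode

variable {F : Type} [Field F] {k t Δ Θ : ℕ} (A : Matrix (Fin k) (Fin t) F)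
  (B : Matrix (Fin k) (Fin Δ) F) (G : Matrix (Fin k) (Fin Θ) F)

lemma maskMap_apply (x : (Fin Δ → F) × (Fin Θ → F)) :
    maskMap B G x = B.mulVec x.1 + G.mulVec x.2 := rfl

lemma encoderMap_apply (ω : SampleSpace F t Δ Θ) :
    encoderMap A B G ω = A.mulVec ω.1 + B.mulVec ω.2.1 + G.mulVec ω.2.2 :=
  (add_assoc _ _ _).symm

lemma range_maskMap_le : LinearMap.range (maskMap B G) ≤ LinearMap.range (encoderMap A B G) := by
  rintro _ ⟨x, rfl⟩
  exact ⟨(0, x), by simp [encoderMap]⟩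

lemma mulVec_mem_range_encoderMap (m : Fin t → F) :
    A.mulVec m ∈ LinearMap.range (encoderMap A B G) :=
  ⟨(m, 0), by simp [encoderMap]⟩

lemma mem_range_encoderMap_of_sub_mem {m : Fin t → F} {c : Fin k → F}
    (h : c - A.mulVec m ∈ LinearMap.range (maskMap B G)) :
    c ∈ LinearMap.range (encoderMap A B G) := by
  simpa using add_mem (range_maskMap_le A B G h) (mulVec_mem_range_encoderMap A B G m)

variable [Fintype F] [DecidableEq F]

open Classical in
lemma jointMC_eq (m : Fin t → F) (c : Fin k → F) :
    jointMC A B G m c = if c - A.mulVec m ∈ LinearMap.range (maskMap B G) then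
      ((Fintype.card (Fin t → F) : ℝ) * Nat.card (LinearMap.range (maskMap B G)))⁻¹ else 0 := by
  have hcard : #{ω : SampleSpace F t Δ Θ |
      ω.1 = m ∧ A.mulVec ω.1 + B.mulVec ω.2.1 + G.mulVec ω.2.2 = c} =
      #{x | maskMap B G x = c - A.mulVec m} := by
    symm
    refine Finset.card_bij (fun x _ => (m, x)) ?_ ?_ ?_
    · intro x hx
      rw [mem_filter, maskMap_apply] at hx
      simp only [mem_filter, mem_univ, true_and]
      rw [add_assoc, hx.2, add_sub_cancel]
    · intro x _ y _ h
      exact (Prod.mk.inj h).2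
    · rintro ⟨m', x⟩ hx
      simp only [mem_filter, mem_univ, true_and] at hx
      obtain ⟨rfl, hx⟩ := hx
      refine ⟨x, ?_, rfl⟩
      rw [mem_filter, maskMap_apply, and_iff_right (mem_univ _), ← hx, add_assoc, add_sub_cancel_left]
  have hfib := LinearMap.card_fiber_mul_card_range (maskMap B G) (c - A.mulVec m)
  have hn : (Nat.card (LinearMap.range (maskMap B G)) : ℝ) ≠ 0 := by
    exact_mod_cast Nat.card_pos.ne'
  have hX : (Fintype.card ((Fin Δ → F) × (Fin Θ → F)) : ℝ) ≠ 0 := by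
    exact_mod_cast Fintype.card_ne_zero
  have ht : (Fintype.card (Fin t → F) : ℝ) ≠ 0 := by
    exact_mod_cast Fintype.card_ne_zero
  have hfib' := congrArg (Nat.cast : ℕ → ℝ) hfib
  rw [jointMC, hcard, Fintype.card_prod (Fin t → F)]
  rw [Nat.cast_mul] at hfib' ⊢
  split_ifs at hfib' ⊢ with h
  · rw [div_eq_iff (mul_ne_zero ht hX), inv_mul_eq_div, eq_div_iff (mul_ne_zero ht hn), ← hfib']
    ring
  · rw [Nat.cast_zero, mul_eq_zero, or_iff_left hn] at hfib'
    rw [hfib', zero_div]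

lemma pM_eq (m : Fin t → F) : pM A B G m = (Fintype.card (Fin t → F) : ℝ)⁻¹ := by
  classical
  have hn : (Nat.card (LinearMap.range (maskMap B G)) : ℝ) ≠ 0 := by
    exact_mod_cast Nat.card_pos.ne'
  have hcount : #{c | c - A.mulVec m ∈ LinearMap.range (maskMap B G)} =
      Nat.card (LinearMap.range (maskMap B G)) := by
    rw [← Fintype.card_subtype, ← Nat.card_eq_fintype_card]
    exact Nat.card_congr ((Equiv.subRight (A.mulVec m)).subtypeEquiv fun _ => Iff.rfl)
  simp only [pM, jointMC_eq]
  rw [← Finset.sum_filter, Finset.sum_const, hcount, nsmul_eq_mul, mul_inv]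
  field_simp

open Classical in
lemma pC_eq (c : Fin k → F) :
    pC A B G c = if c ∈ LinearMap.range (encoderMap A B G) then
      (Nat.card (LinearMap.range (encoderMap A B G)) : ℝ)⁻¹ else 0 := by
  have hcard : ∑ m : Fin t → F, #{ω : SampleSpace F t Δ Θ |
      ω.1 = m ∧ A.mulVec ω.1 + B.mulVec ω.2.1 + G.mulVec ω.2.2 = c} =
      #{ω | encoderMap A B G ω = c} := by
    rw [Finset.card_eq_sum_card_fiberwise (f := Prod.fst) (t := univ) (by simp)]
    refine Finset.sum_congr rfl fun m _ => ?_
    rw [Finset.filter_filter]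
    simp only [encoderMap_apply, and_comm]
  have hfib := LinearMap.card_fiber_mul_card_range (encoderMap A B G) c
  have hn : (Nat.card (LinearMap.range (encoderMap A B G)) : ℝ) ≠ 0 := by
    exact_mod_cast Nat.card_pos.ne'
  have hX : (Fintype.card (SampleSpace F t Δ Θ) : ℝ) ≠ 0 := by
    exact_mod_cast Fintype.card_ne_zero
  have hfib' := congrArg (Nat.cast : ℕ → ℝ) hfib
  simp only [pC, jointMC]
  rw [← Finset.sum_div, ← Nat.cast_sum, hcard]
  rw [Nat.cast_mul] at hfib'
  split_ifs at hfib' ⊢ with h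
  · rw [div_eq_iff hX, inv_mul_eq_div, eq_div_iff hn, hfib']
  · rw [Nat.cast_zero, mul_eq_zero, or_iff_left hn] at hfib'
    rw [hfib', zero_div]

/-- The mutual information is the logarithm of the index of the range of the mask in the range
of the encoder. -/
lemma miMC_eq_logb_div : miMC A B G =
    Real.logb 2 ((Nat.card (LinearMap.range (encoderMap A B G)) : ℝ) /
      Nat.card (LinearMap.range (maskMap B G))) := by
  classical
  have hn : (Nat.card (LinearMap.range (maskMap B G)) : ℝ) ≠ 0 := by
    exact_mod_cast Nat.card_pos.ne'
  have hN : (Nat.card (LinearMap.range (encoderMap A B G)) : ℝ) ≠ 0 := by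
    exact_mod_cast Nat.card_pos.ne'
  have ht : (Fintype.card (Fin t → F) : ℝ) ≠ 0 := by
    exact_mod_cast Fintype.card_ne_zero
  have hterm : ∀ m c, jointMC A B G m c *
      Real.logb 2 (jointMC A B G m c / (pM A B G m * pC A B G c)) =
      jointMC A B G m c * Real.logb 2 ((Nat.card (LinearMap.range (encoderMap A B G)) : ℝ) /
        Nat.card (LinearMap.range (maskMap B G))) := by
    intro m c
    by_cases h : c - A.mulVec m ∈ LinearMap.range (maskMap B G)
    · rw [jointMC_eq, pM_eq, pC_eq, if_pos h, if_pos (mem_range_encoderMap_of_sub_mem A B G h)]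
      congr 2
      field_simp
    · rw [jointMC_eq, if_neg h, zero_mul, zero_mul]
  have htotal : ∑ m, ∑ c, jointMC A B G m c = 1 := by
    change ∑ m, pM A B G m = 1
    simp only [pM_eq]
    rw [Finset.sum_const, Finset.card_univ, nsmul_eq_mul, mul_inv_cancel₀ ht]
  simp only [miMC, hterm, ← Finset.sum_mul, htotal, one_mul]

lemma miMC_eq_finrank_sub_mul : miMC A B G =
    ((Module.finrank F (LinearMap.range (encoderMap A B G)) : ℝ) -
      Module.finrank F (LinearMap.range (maskMap B G))) * Real.logb 2 (Fintype.card F) := by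
  have hq : (Fintype.card F : ℝ) ≠ 0 := by exact_mod_cast Fintype.card_ne_zero
  rw [miMC_eq_logb_div, Module.natCard_eq_pow_finrank (K := F),
    Module.natCard_eq_pow_finrank (K := F) (V := LinearMap.range (maskMap B G)),
    Nat.card_eq_fintype_card, Nat.cast_pow, Nat.cast_pow,
    Real.logb_div (pow_ne_zero _ hq) (pow_ne_zero _ hq), Real.logb_pow, Real.logb_pow, sub_mul]

lemma miMC_eq_zero_or_logb_le :
    miMC A B G = 0 ∨ Real.logb 2 (Fintype.card F) ≤ miMC A B G := by
  have hq := one_le_logb_two_card F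
  rw [miMC_eq_finrank_sub_mul]
  rcases (Submodule.finrank_mono (range_maskMap_le A B G)).eq_or_lt with h | h
  · left
    rw [h, sub_self, zero_mul]
  · right
    refine le_mul_of_one_le_left (zero_le_one.trans hq) (le_sub_iff_add_le'.mpr ?_)
    exact_mod_cast h

lemma jointMC_eq_mul_of_miMC_eq_zero (h : miMC A B G = 0) (m : Fin t → F) (c : Fin k → F) :
    jointMC A B G m c = pM A B G m * pC A B G c := by
  classical
  rw [miMC_eq_finrank_sub_mul, mul_eq_zero,
    or_iff_left (zero_lt_one.trans_le (one_le_logb_two_card F)).ne', sub_eq_zero,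
    Nat.cast_inj] at h
  have hrange := Submodule.eq_of_le_of_finrank_eq (range_maskMap_le A B G) h.symm
  have hiff : c - A.mulVec m ∈ LinearMap.range (encoderMap A B G) ↔
      c ∈ LinearMap.range (encoderMap A B G) :=
    Submodule.sub_mem_iff_left _ (mulVec_mem_range_encoderMap A B G m)
  simp only [jointMC_eq, pM_eq, pC_eq, hrange, hiff, mul_inv, mul_ite, mul_zero]

end LinearCode

/-- For a linear code `C = AM + BK + GW` with `M, K, W` mutually
independent and uniform, the mutual information `I(M;C)` is either `0` or at least
`log₂|F| ≥ 1`; consequently if `I(M;C) ≤ ε` for some `ε < 1`, then `I(M;C) = 0`, i.e.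
`M` and `C` are independent (perfect secrecy). -/
theorem mi_dichotomy_linear_code {F : Type} [Field F] [Fintype F] [DecidableEq F]
    {k t Δ Θ : ℕ} (A : Matrix (Fin k) (Fin t) F) (B : Matrix (Fin k) (Fin Δ) F)
    (G : Matrix (Fin k) (Fin Θ) F) :
    (miMC A B G = 0 ∨ Real.logb 2 (Fintype.card F) ≤ miMC A B G) ∧
    (1 : ℝ) ≤ Real.logb 2 (Fintype.card F) ∧
    (∀ ε : ℝ, ε < 1 → miMC A B G ≤ ε →
      miMC A B G = 0 ∧
        ∀ (m : Fin t → F) (c : Fin k → F),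
          jointMC A B G m c = pM A B G m * pC A B G c) := by
  have hdich := miMC_eq_zero_or_logb_le A B G
  have hq := one_le_logb_two_card F
  refine ⟨hdich, hq, fun ε hε hle => ?_⟩
  have h0 : miMC A B G = 0 := hdich.resolve_right fun h => by linarith
  exact ⟨h0, jointMC_eq_mul_of_miMC_eq_zero A B G h0⟩
end
end

section
/- (Output Statistics of Random Binning.) Let (M₁, …, M_t, C) be random variables on the finite set ∏_{i=1}^t ℳᵢ × 𝒞 with joint pmf p, and let (M₁([n]), …, M_t([n]), C([n])) denote n i.i.d. copies. Fix rates R₁, …, R_t > 0 and let 𝔅ᵢ : ℳᵢⁿ → [⌈2^{nRᵢ}⌉], i ∈ [t], be mutually independent uniformly random functions (each sequence in ℳᵢⁿ is mapped independently and uniformly to a bin index). Let M̄ᵢ = 𝔅ᵢ(Mᵢ([n])) and let P denote the joint pmf of (C([n]), M̄₁, …, M̄_t) induced by a fixed realization of the binnings. If for every nonempty subset S ⊆ [t] it holds that ∑_{i∈S} Rᵢ < H(M_S | C), then lim_{n→∞} 𝔼_𝔅 ‖ P_{C([n]), M̄₁,…,M̄_t} − p_{C([n])} ⊗ ∏_{i=1}^t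 p^U_{[⌈2^{nRᵢ}⌉]} ‖₁ = 0, where the expectation 𝔼_𝔅 is over the random choice of the binning functions and p^U_S denotes the uniform pmf on S. -/
open Finset

noncomputable section

namespace OSRB

variable {t : ℕ} {M : Fin t → Type} [∀ i, Fintype (M i)] [∀ i, DecidableEq (M i)]
  {C : Type} [Fintype C] [DecidableEq C]

/-- Marginal pmf of `C`. -/
def pC (p : ((∀ i, M i) × C) → ℝ) (c : C) : ℝ := ∑ m : ∀ i, M i, p (m, c)

/-- Joint pmf of `(M_S, C)` for a subset `S` of the messages. -/
def pSC (p : ((∀ i, M i) × C) → ℝ) (S : Finset (Fin t))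
    (f : ∀ i : S, M i.1) (c : C) : ℝ :=
  ∑ m : ∀ i, M i, if ∀ i : S, m i.1 = f i then p (m, c) else 0

/-- Conditional entropy `H(M_S | C)` in bits (terms with zero probability vanish,
since `Real.logb 2 0 = 0`). -/
def condEnt (p : ((∀ i, M i) × C) → ℝ) (S : Finset (Fin t)) : ℝ :=
  - ∑ f : ∀ i : S, M i.1, ∑ c : C,
      pSC p S f c * Real.logb 2 (pSC p S f c / pC p c)

/-- The number of bins `⌈2^{nRᵢ}⌉` for source `i` at blocklength `n`. -/
def nbins (R : Fin t → ℝ) (n : ℕ) (i : Fin t) : ℕ := ⌈(2 : ℝ) ^ ((n : ℝ) * R i)⌉₊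

/-- The pmf of `(C([n]), M̄₁, …, M̄_t)` induced by a fixed realization `𝔟` of the
binning functions, where `M̄ᵢ = 𝔟ᵢ(Mᵢ([n]))` and the underlying source is `n` i.i.d.
copies of `(M₁, …, M_t, C) ∼ p`. -/
def Pind (p : ((∀ i, M i) × C) → ℝ) (R : Fin t → ℝ) (n : ℕ)
    (𝔟 : ∀ i, (Fin n → M i) → Fin (nbins R n i))
    (c : Fin n → C) (mb : ∀ i, Fin (nbins R n i)) : ℝ :=
  ∑ ω : Fin n → ((∀ i, M i) × C),
    if (∀ j, (ω j).2 = c j) ∧ (∀ i, 𝔟 i (fun j => (ω j).1 i) = mb i)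
    then ∏ j, p (ω j) else 0

/-- The ideal pmf `p_{C([n])} ⊗ ∏ᵢ p^U_{[⌈2^{nRᵢ}⌉]}`. -/
def Qideal (p : ((∀ i, M i) × C) → ℝ) (R : Fin t → ℝ) (n : ℕ)
    (c : Fin n → C) (_mb : ∀ i, Fin (nbins R n i)) : ℝ :=
  (∏ j, pC p (c j)) * ∏ i, ((nbins R n i : ℝ))⁻¹

/-- The expected total variation distance
`𝔼_𝔅 ‖P_{C([n]),M̄} − p_{C([n])} ⊗ ∏ᵢ p^U‖₁`, where the expectation is the average
over all (uniformly random, mutually independent) binning functions. -/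
def Ebin (p : ((∀ i, M i) × C) → ℝ) (R : Fin t → ℝ) (n : ℕ) : ℝ :=
  (Fintype.card (∀ i, (Fin n → M i) → Fin (nbins R n i)) : ℝ)⁻¹ *
    ∑ 𝔟 : ∀ i, (Fin n → M i) → Fin (nbins R n i),
      2⁻¹ * ∑ c : Fin n → C, ∑ mb : ∀ i, Fin (nbins R n i),
        |Pind p R n 𝔟 c mb - Qideal p R n c mb|

/-! ### Averages over uniformly random functions -/

theorem avg_indicator_fun {X K : Type*} [Fintype X] [DecidableEq X] [Fintype K] [DecidableEq K]
    [Nonempty K] (s : Finset X) (k : K) :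
    (Fintype.card (X → K) : ℝ)⁻¹ * ∑ b : X → K, (if ∀ x ∈ s, b x = k then (1 : ℝ) else 0) =
      ((Fintype.card K : ℝ)⁻¹) ^ s.card := by
  have hK : (Fintype.card K : ℝ) ≠ 0 := by exact_mod_cast Fintype.card_ne_zero
  have h1 : ∀ b : X → K, (if ∀ x ∈ s, b x = k then (1 : ℝ) else 0) =
      ∏ x, (if x ∈ s then (if b x = k then (1 : ℝ) else 0) else 1) := by
    intro b
    rw [Finset.prod_ite_mem, Finset.univ_inter, Finset.prod_ite_zero]
    simp
  have h2 : ∑ b : X → K, (if ∀ x ∈ s, b x = k then (1 : ℝ) else 0) =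
      ∏ x, (if x ∈ s then (1 : ℝ) else Fintype.card K) := by
    simp_rw [h1]
    rw [← Fintype.piFinset_univ, ← Finset.prod_univ_sum (fun _ => (Finset.univ : Finset K))
      (fun x y => if x ∈ s then (if y = k then (1 : ℝ) else 0) else 1)]
    refine Finset.prod_congr rfl fun x _ => ?_
    split_ifs <;> simp
  have h3 : (Fintype.card (X → K) : ℝ)⁻¹ = ∏ _x : X, (Fintype.card K : ℝ)⁻¹ := by
    simp
  rw [h2, h3, ← Finset.prod_mul_distrib, ← Finset.prod_const,
    ← Finset.prod_subset (Finset.subset_univ s)]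
  · exact Finset.prod_congr rfl fun x hx => by simp [hx]
  · intro x _ hx
    simp [hx, hK]

section Binning

variable {ι : Type*} [Fintype ι] [DecidableEq ι] {X K : ι → Type*}
  [∀ i, Fintype (X i)] [∀ i, DecidableEq (X i)] [∀ i, Fintype (K i)] [∀ i, DecidableEq (K i)]
  [∀ i, Nonempty (K i)]

theorem avg_indicator_pi (s : ∀ i, Finset (X i)) (k : ∀ i, K i) :
    (Fintype.card (∀ i, X i → K i) : ℝ)⁻¹ *
      ∑ b : ∀ i, X i → K i, (if ∀ i, ∀ x ∈ s i, b i x = k i then (1 : ℝ) else 0) =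
      ∏ i, ((Fintype.card (K i) : ℝ)⁻¹) ^ (s i).card := by
  have h1 : ∀ b : ∀ i, X i → K i, (if ∀ i, ∀ x ∈ s i, b i x = k i then (1 : ℝ) else 0) =
      ∏ i, (if ∀ x ∈ s i, b i x = k i then (1 : ℝ) else 0) := by
    intro b
    rw [Finset.prod_ite_zero]
    simp
  simp_rw [h1, ← avg_indicator_fun (s _) (k _)]
  rw [Finset.prod_mul_distrib, ← Fintype.piFinset_univ,
    ← Finset.prod_univ_sum (fun i => (Finset.univ : Finset (X i → K i)))
      (fun i y => if ∀ x ∈ s i, y x = k i then (1 : ℝ) else 0)]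
  congr 1
  rw [Fintype.card_pi, Nat.cast_prod, Finset.prod_inv_distrib]

/-- Probability that a random binning sends `x` to the bin `k`. -/
theorem avg_bin (x : ∀ i, X i) (k : ∀ i, K i) :
    (Fintype.card (∀ i, X i → K i) : ℝ)⁻¹ *
      ∑ b : ∀ i, X i → K i, (if ∀ i, b i (x i) = k i then (1 : ℝ) else 0) =
      ∏ i, (Fintype.card (K i) : ℝ)⁻¹ := by
  simpa using avg_indicator_pi (fun i => {x i}) k

/-- Probability that a random binning sends both `x` and `y` to the bin `k`. -/
theorem avg_bin_mul_bin (x y : ∀ i, X i) (k : ∀ i, K i) :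
    (Fintype.card (∀ i, X i → K i) : ℝ)⁻¹ *
      ∑ b : ∀ i, X i → K i, (if ∀ i, b i (x i) = k i then (1 : ℝ) else 0) *
        (if ∀ i, b i (y i) = k i then (1 : ℝ) else 0) =
      (∏ i, (Fintype.card (K i) : ℝ)⁻¹) ^ 2 *
        ∏ i ∈ Finset.univ.filter (fun i => y i = x i), (Fintype.card (K i) : ℝ) := by
  have hK : ∀ i, (Fintype.card (K i) : ℝ) ≠ 0 := fun i => by exact_mod_cast Fintype.card_ne_zero
  rw [← Finset.prod_pow, Finset.prod_filter, ← Finset.prod_mul_distrib]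
  trans ∏ i, ((Fintype.card (K i) : ℝ)⁻¹) ^ ({x i, y i} : Finset (X i)).card
  · rw [← avg_indicator_pi (fun i => {x i, y i}) k]
    congr 1
    refine Finset.sum_congr rfl fun b _ => ?_
    rw [ite_zero_mul_ite_zero, mul_one]
    refine if_congr ?_ rfl rfl
    simp [forall_and]
  · refine Finset.prod_congr rfl fun i _ => ?_
    split_ifs with h
    · have := hK i
      rw [h]
      simp
      field_simp
    · rw [Finset.card_pair (Ne.symm h), mul_one]

theorem avg_sq_bin_sum_sub_mean_le (w : (∀ i, X i) → ℝ) (hw : ∀ x, 0 ≤ w x) (k : ∀ i, K i) :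
    (Fintype.card (∀ i, X i → K i) : ℝ)⁻¹ * ∑ b : ∀ i, X i → K i,
      ((∑ x, if ∀ i, b i (x i) = k i then w x else 0) -
        (∑ x, w x) * ∏ i, (Fintype.card (K i) : ℝ)⁻¹) ^ 2 ≤
      (∏ i, (Fintype.card (K i) : ℝ)⁻¹) ^ 2 *
        ∑ U ∈ Finset.univ.filter (fun U : Finset ι => U.Nonempty),
          (∏ i ∈ U, (Fintype.card (K i) : ℝ)) *
            ∑ x, w x * ∑ y, if ∀ i ∈ U, y i = x i then w y else 0 := by
  set N : ℝ := (Fintype.card (∀ i, X i → K i) : ℝ)⁻¹ with hN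
  set β : ℝ := ∏ i, (Fintype.card (K i) : ℝ)⁻¹ with hβ
  set I : (∀ i, X i → K i) → (∀ i, X i) → ℝ :=
    fun b x => if ∀ i, b i (x i) = k i then (1 : ℝ) else 0 with hI
  have hN1 : N * ∑ _b : ∀ i, X i → K i, (1 : ℝ) = 1 := by
    simp only [hN, Finset.sum_const, Finset.card_univ, nsmul_eq_mul, mul_one]
    exact inv_mul_cancel₀ (by exact_mod_cast Fintype.card_ne_zero)
  have hI1 : ∀ x, N * ∑ b, I b x = β := fun x => avg_bin x k
  have hI2 : ∀ x y, N * ∑ b, I b x * I b y =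
      β ^ 2 * ∏ i ∈ Finset.univ.filter (fun i => y i = x i), (Fintype.card (K i) : ℝ) :=
    fun x y => avg_bin_mul_bin x y k
  have hexp : ∀ b : ∀ i, X i → K i,
      ((∑ x, if ∀ i, b i (x i) = k i then w x else 0) - (∑ x, w x) * β) ^ 2 =
        ∑ x, ∑ y, w x * w y * (I b x * I b y - β * I b x - β * I b y + β ^ 2 * 1) := by
    intro b
    have : (∑ x, if ∀ i, b i (x i) = k i then w x else 0) - (∑ x, w x) * β =
        ∑ x, w x * (I b x - β) := by
      simp only [hI, mul_sub, Finset.sum_sub_distrib, Finset.sum_mul, mul_ite, mul_one, mul_zero]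
    rw [this, sq, Finset.sum_mul_sum]
    refine Finset.sum_congr rfl fun x _ => Finset.sum_congr rfl fun y _ => ?_
    ring
  have hvar : N * ∑ b : ∀ i, X i → K i,
      ((∑ x, if ∀ i, b i (x i) = k i then w x else 0) - (∑ x, w x) * β) ^ 2 =
        ∑ x, ∑ y, w x * w y * (N * ∑ b, I b x * I b y - β ^ 2) := by
    simp_rw [hexp]
    rw [Finset.sum_comm, Finset.mul_sum]
    refine Finset.sum_congr rfl fun x _ => ?_
    rw [Finset.sum_comm, Finset.mul_sum]
    refine Finset.sum_congr rfl fun y _ => ?_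
    rw [← Finset.mul_sum]
    simp only [Finset.sum_add_distrib, Finset.sum_sub_distrib, ← Finset.mul_sum]
    linear_combination (w x * w y) * (-β * hI1 x - β * hI1 y + β ^ 2 * hN1)
  have hK : ∀ i, (0 : ℝ) ≤ Fintype.card (K i) := fun i => Nat.cast_nonneg _
  have hpair : ∀ x y : ∀ i, X i,
      (∏ i ∈ Finset.univ.filter (fun i => y i = x i), (Fintype.card (K i) : ℝ)) - 1 ≤
        ∑ U ∈ Finset.univ.filter (fun U : Finset ι => U.Nonempty),
          (∏ i ∈ U, (Fintype.card (K i) : ℝ)) * (if ∀ i ∈ U, y i = x i then 1 else 0) := by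
    intro x y
    have hnn : ∀ U ∈ Finset.univ.filter (fun U : Finset ι => U.Nonempty), (0 : ℝ) ≤
        (∏ i ∈ U, (Fintype.card (K i) : ℝ)) * (if ∀ i ∈ U, y i = x i then 1 else 0) :=
      fun U _ => mul_nonneg (Finset.prod_nonneg fun i _ => hK i) (by split_ifs <;> norm_num)
    rcases (Finset.univ.filter (fun i => y i = x i)).eq_empty_or_nonempty with h | h
    · rw [h]
      simpa using Finset.sum_nonneg hnn
    · refine le_trans ?_ (Finset.single_le_sum hnn
        (Finset.mem_filter.2 ⟨Finset.mem_univ _, h⟩))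
      rw [if_pos (by simp)]
      linarith
  rw [hvar]
  calc ∑ x, ∑ y, w x * w y * (N * ∑ b, I b x * I b y - β ^ 2)
      ≤ ∑ x, ∑ y, w x * w y * (β ^ 2 *
          ∑ U ∈ Finset.univ.filter (fun U : Finset ι => U.Nonempty),
            (∏ i ∈ U, (Fintype.card (K i) : ℝ)) * (if ∀ i ∈ U, y i = x i then 1 else 0)) := by
        refine Finset.sum_le_sum fun x _ => Finset.sum_le_sum fun y _ =>
          mul_le_mul_of_nonneg_left ?_ (mul_nonneg (hw x) (hw y))
        rw [hI2]
        nlinarith [mul_le_mul_of_nonneg_left (hpair x y) (sq_nonneg β)]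
    _ = _ := by
        simp only [Finset.mul_sum]
        simp_rw [Finset.sum_comm (s := (Finset.univ : Finset (∀ i, X i)))
          (t := Finset.univ.filter (fun U : Finset ι => U.Nonempty))]
        refine Finset.sum_congr rfl fun U _ => Finset.sum_congr rfl fun x _ =>
          Finset.sum_congr rfl fun y _ => ?_
        split_ifs <;> ring

/-- If every point of the support of `w` shares its coordinates in each nonempty `U` with at most
an `ε U` fraction of the mass, then random binning is close to uniform on average. -/
theorem avg_abs_bin_sum_sub_mean_le (w : (∀ i, X i) → ℝ) (hw : ∀ x, 0 ≤ w x) (k : ∀ i, K i)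
    (W : ℝ) (hwW : ∑ x, w x ≤ W) (ε : Finset ι → ℝ) (hε0 : ∀ U, 0 ≤ ε U)
    (hε : ∀ U : Finset ι, U.Nonempty → ∀ x, 0 < w x →
      (∑ y, if ∀ i ∈ U, y i = x i then w y else 0) ≤ ε U * W) :
    (Fintype.card (∀ i, X i → K i) : ℝ)⁻¹ * ∑ b : ∀ i, X i → K i,
      |(∑ x, if ∀ i, b i (x i) = k i then w x else 0) -
        (∑ x, w x) * ∏ i, (Fintype.card (K i) : ℝ)⁻¹| ≤
      (∏ i, (Fintype.card (K i) : ℝ)⁻¹) * W *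
        √(∑ U ∈ Finset.univ.filter (fun U : Finset ι => U.Nonempty),
          (∏ i ∈ U, (Fintype.card (K i) : ℝ)) * ε U) := by
  have hW : 0 ≤ W := (Finset.sum_nonneg fun x _ => hw x).trans hwW
  have hK : ∀ i, (0 : ℝ) ≤ Fintype.card (K i) := fun i => Nat.cast_nonneg _
  have hβ : 0 ≤ ∏ i, (Fintype.card (K i) : ℝ)⁻¹ :=
    Finset.prod_nonneg fun i _ => inv_nonneg.2 (hK i)
  have hcard : (0 : ℝ) < Fintype.card (∀ i, X i → K i) := by exact_mod_cast Fintype.card_pos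
  have hinner : ∀ U : Finset ι, U.Nonempty →
      ∑ x, w x * ∑ y, (if ∀ i ∈ U, y i = x i then w y else 0) ≤ W ^ 2 * ε U := by
    intro U hU
    calc ∑ x, w x * ∑ y, (if ∀ i ∈ U, y i = x i then w y else 0)
        ≤ ∑ x, w x * (ε U * W) := by
          refine Finset.sum_le_sum fun x _ => ?_
          rcases (hw x).eq_or_lt with h | h
          · simp [← h]
          · exact mul_le_mul_of_nonneg_left (hε U hU x h) (hw x)
      _ = (∑ x, w x) * (ε U * W) := by rw [Finset.sum_mul]
      _ ≤ W * (ε U * W) := mul_le_mul_of_nonneg_right hwW (mul_nonneg (hε0 U) hW)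
      _ = W ^ 2 * ε U := by ring
  have hsq : (Fintype.card (∀ i, X i → K i) : ℝ)⁻¹ * ∑ b : ∀ i, X i → K i,
      ((∑ x, if ∀ i, b i (x i) = k i then w x else 0) -
        (∑ x, w x) * ∏ i, (Fintype.card (K i) : ℝ)⁻¹) ^ 2 ≤
      ((∏ i, (Fintype.card (K i) : ℝ)⁻¹) * W) ^ 2 *
        ∑ U ∈ Finset.univ.filter (fun U : Finset ι => U.Nonempty),
          (∏ i ∈ U, (Fintype.card (K i) : ℝ)) * ε U := by
    refine (avg_sq_bin_sum_sub_mean_le w hw k).trans ?_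
    rw [mul_pow, mul_assoc]
    refine mul_le_mul_of_nonneg_left ?_ (sq_nonneg _)
    rw [Finset.mul_sum]
    refine Finset.sum_le_sum fun U hU => ?_
    have := mul_le_mul_of_nonneg_left (hinner U (Finset.mem_filter.1 hU).2)
      (Finset.prod_nonneg fun i (_ : i ∈ U) => hK i)
    linarith
  rw [← Real.sqrt_sq (mul_nonneg hβ hW), ← Real.sqrt_mul (sq_nonneg _)]
  refine Real.le_sqrt_of_sq_le (le_trans ?_ hsq)
  have := sq_sum_le_card_mul_sum_sq (s := (Finset.univ : Finset (∀ i, X i → K i)))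
    (f := fun b => |(∑ x, if ∀ i, b i (x i) = k i then w x else 0) -
        (∑ x, w x) * ∏ i, (Fintype.card (K i) : ℝ)⁻¹|)
  simp only [sq_abs, Finset.card_univ] at this
  rw [mul_pow, sq (_)⁻¹, mul_assoc]
  refine mul_le_mul_of_nonneg_left ?_ (inv_nonneg.2 hcard.le)
  rwa [inv_mul_le_iff₀ hcard]

/-- One-shot output statistics of random binning. -/
theorem avg_tv_bin_le {Γ : Type*} [Fintype Γ] (q : (∀ i, X i) → Γ → ℝ) (hq : ∀ x c, 0 ≤ q x c)
    (good : (∀ i, X i) → Γ → Prop) [∀ x c, Decidable (good x c)]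
    (ε : Finset ι → ℝ) (hε0 : ∀ U, 0 ≤ ε U)
    (hε : ∀ U : Finset ι, U.Nonempty → ∀ x c, good x c → 0 < q x c →
      (∑ y, if ∀ i ∈ U, y i = x i then q y c else 0) ≤ ε U * ∑ y, q y c) :
    (Fintype.card (∀ i, X i → K i) : ℝ)⁻¹ * ∑ b : ∀ i, X i → K i,
      2⁻¹ * ∑ c, ∑ k : ∀ i, K i, |(∑ x, if ∀ i, b i (x i) = k i then q x c else 0) -
        (∑ x, q x c) * ∏ i, (Fintype.card (K i) : ℝ)⁻¹| ≤
      (∑ c, ∑ x, if good x c then 0 else q x c) +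
        2⁻¹ * (∑ c, ∑ x, q x c) * √(∑ U ∈ Finset.univ.filter (fun U : Finset ι => U.Nonempty),
          (∏ i ∈ U, (Fintype.card (K i) : ℝ)) * ε U) := by
  have hK : ∀ i, (0 : ℝ) ≤ Fintype.card (K i) := fun i => Nat.cast_nonneg _
  set β : ℝ := ∏ i, (Fintype.card (K i) : ℝ)⁻¹ with hβdef
  set N : ℝ := (Fintype.card (∀ i, X i → K i) : ℝ)⁻¹ with hN
  set σ : ℝ := √(∑ U ∈ Finset.univ.filter (fun U : Finset ι => U.Nonempty),
          (∏ i ∈ U, (Fintype.card (K i) : ℝ)) * ε U) with hσ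
  have hβ : 0 ≤ β := Finset.prod_nonneg fun i _ => inv_nonneg.2 (hK i)
  have hN0 : 0 ≤ N := inv_nonneg.2 (Nat.cast_nonneg _)
  have hN1 : N * ∑ _b : ∀ i, X i → K i, (1 : ℝ) = 1 := by
    simp only [hN, Finset.sum_const, Finset.card_univ, nsmul_eq_mul, mul_one]
    exact inv_mul_cancel₀ (by exact_mod_cast Fintype.card_ne_zero)
  have hβ1 : ∑ _k : ∀ i, K i, β = 1 := by
    rw [Finset.sum_const, Finset.card_univ, Fintype.card_pi, nsmul_eq_mul, Nat.cast_prod, hβdef,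
      Finset.prod_inv_distrib]
    exact mul_inv_cancel₀ (Finset.prod_ne_zero_iff.2 fun i _ => by
      exact_mod_cast Fintype.card_ne_zero)
  set w : (∀ i, X i) → Γ → ℝ := fun x c => if good x c then q x c else 0 with hw
  set v : (∀ i, X i) → Γ → ℝ := fun x c => if good x c then 0 else q x c with hv
  have hw0 : ∀ x c, 0 ≤ w x c := fun x c => by simp only [hw]; split_ifs <;> simp [hq]
  have hv0 : ∀ x c, 0 ≤ v x c := fun x c => by simp only [hv]; split_ifs <;> simp [hq]
  have hwq : ∀ x c, w x c ≤ q x c := fun x c => by simp only [hw]; split_ifs <;> simp [hq]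
  have hqwv : ∀ x c, q x c = w x c + v x c := fun x c => by
    simp only [hw, hv]; split_ifs <;> simp
  have hsplit : ∀ (b : ∀ i, X i → K i) c (k : ∀ i, K i),
      |(∑ x, if ∀ i, b i (x i) = k i then q x c else 0) - (∑ x, q x c) * β| ≤
        |(∑ x, if ∀ i, b i (x i) = k i then w x c else 0) - (∑ x, w x c) * β| +
          ((∑ x, if ∀ i, b i (x i) = k i then v x c else 0) + (∑ x, v x c) * β) := by
    intro b c k
    have e1 : (∑ x, if ∀ i, b i (x i) = k i then q x c else 0) =
        (∑ x, if ∀ i, b i (x i) = k i then w x c else 0) +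
          ∑ x, if ∀ i, b i (x i) = k i then v x c else 0 := by
      rw [← Finset.sum_add_distrib]
      refine Finset.sum_congr rfl fun x _ => ?_
      rw [hqwv]
      split_ifs <;> simp
    have e2 : ∑ x, q x c = ∑ x, w x c + ∑ x, v x c := by
      rw [← Finset.sum_add_distrib]
      exact Finset.sum_congr rfl fun x _ => hqwv x c
    have e3 : 0 ≤ ∑ x, if ∀ i, b i (x i) = k i then v x c else 0 :=
      Finset.sum_nonneg fun x _ => by split_ifs <;> simp [hv0]
    have e4 : 0 ≤ (∑ x, v x c) * β :=
      mul_nonneg (Finset.sum_nonneg fun x _ => hv0 x c) hβ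
    rw [e1, e2]
    calc _ = |((∑ x, if ∀ i, b i (x i) = k i then w x c else 0) - (∑ x, w x c) * β) +
          ((∑ x, if ∀ i, b i (x i) = k i then v x c else 0) - (∑ x, v x c) * β)| := by
            congr 1; ring
      _ ≤ _ := (abs_add_le _ _).trans (by
        gcongr
        rw [abs_le]
        constructor <;> linarith)
  have hvsum : ∀ (b : ∀ i, X i → K i) c,
      ∑ k : ∀ i, K i, ((∑ x, if ∀ i, b i (x i) = k i then v x c else 0) + (∑ x, v x c) * β) =
        2 * ∑ x, v x c := by
    intro b c
    rw [Finset.sum_add_distrib, ← Finset.mul_sum, hβ1, Finset.sum_comm, two_mul, mul_one]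
    congr 1
    refine Finset.sum_congr rfl fun x _ => ?_
    simp_rw [← funext_iff]
    simp
  have hgood : ∀ c (k : ∀ i, K i), N * ∑ b : ∀ i, X i → K i,
      |(∑ x, if ∀ i, b i (x i) = k i then w x c else 0) - (∑ x, w x c) * β| ≤
        β * (∑ x, q x c) * σ := by
    intro c k
    refine avg_abs_bin_sum_sub_mean_le (fun x => w x c) (fun x => hw0 x c) k _
      (Finset.sum_le_sum fun x _ => hwq x c) ε hε0 fun U hU x hx => ?_
    have hg : good x c := by
      by_contra hg
      simp [hw, hg] at hx
    refine (Finset.sum_le_sum fun y _ => ?_).trans (hε U hU x c hg (hx.trans_le (hwq x c)))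
    split_ifs
    · exact hwq y c
    · exact le_rfl
  calc N * ∑ b : ∀ i, X i → K i, 2⁻¹ * ∑ c, ∑ k : ∀ i, K i,
        |(∑ x, if ∀ i, b i (x i) = k i then q x c else 0) - (∑ x, q x c) * β|
      ≤ N * ∑ b : ∀ i, X i → K i, 2⁻¹ * ∑ c, ((∑ k : ∀ i, K i,
        |(∑ x, if ∀ i, b i (x i) = k i then w x c else 0) - (∑ x, w x c) * β|) +
          2 * ∑ x, v x c) := by
        gcongr with b _ c _
        rw [← hvsum b c, ← Finset.sum_add_distrib]
        exact Finset.sum_le_sum fun k _ => hsplit b c k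
    _ = (∑ c, ∑ x, v x c) + 2⁻¹ * ∑ c, ∑ k : ∀ i, K i, N * ∑ b : ∀ i, X i → K i,
        |(∑ x, if ∀ i, b i (x i) = k i then w x c else 0) - (∑ x, w x c) * β| := by
        have e : ∀ (A : (∀ i, X i → K i) → ℝ) (D : ℝ),
            N * ∑ b, 2⁻¹ * (A b + 2 * D) = D + 2⁻¹ * (N * ∑ b, A b) := by
          intro A D
          have : ∑ b, 2⁻¹ * (A b + 2 * D) =
              2⁻¹ * ∑ b, A b + D * ∑ _b : ∀ i, X i → K i, (1 : ℝ) := by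
            rw [Finset.mul_sum, Finset.mul_sum, ← Finset.sum_add_distrib]
            exact Finset.sum_congr rfl fun b _ => by ring
          rw [this]
          linear_combination D * hN1
        have e2 : ∀ f g : Γ → ℝ, ∑ c, (f c + 2 * g c) = ∑ c, f c + 2 * ∑ c, g c := by
          intro f g
          rw [Finset.sum_add_distrib, Finset.mul_sum]
        have e3 : ∀ F : (∀ i, X i → K i) → Γ → (∀ i, K i) → ℝ,
            N * ∑ b, ∑ c, ∑ k, F b c k = ∑ c, ∑ k, N * ∑ b, F b c k := by
          intro F
          simp_rw [← Finset.mul_sum]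
          rw [Finset.sum_comm]
          exact congrArg _ (Finset.sum_congr rfl fun c _ => Finset.sum_comm)
        simp_rw [e2]
        rw [e, e3]
    _ ≤ (∑ c, ∑ x, v x c) + 2⁻¹ * ∑ c, ∑ k : ∀ i, K i, β * (∑ x, q x c) * σ := by
        refine add_le_add le_rfl (mul_le_mul_of_nonneg_left ?_ (by norm_num))
        exact Finset.sum_le_sum fun c _ => Finset.sum_le_sum fun k _ => hgood c k
    _ = _ := by
        have : ∀ c, ∑ _k : ∀ i, K i, β * (∑ x, q x c) * σ = (∑ x, q x c) * σ := by
          intro c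
          simp_rw [mul_assoc]
          rw [← Finset.sum_mul, hβ1, one_mul]
        simp_rw [this]
        rw [← Finset.sum_mul]
        ring

end Binning

/-! ### A Chernoff bound -/

theorem exists_pos_sum_mul_exp_lt_one {α : Type*} [Fintype α] (p h : α → ℝ) (hp1 : ∑ x, p x = 1)
    (hneg : ∑ x, p x * h x < 0) : ∃ s : ℝ, 0 < s ∧ ∑ x, p x * Real.exp (s * h x) < 1 := by
  have hd : HasDerivAt (fun s : ℝ => ∑ x, p x * Real.exp (s * h x)) (∑ x, p x * h x) 0 := by
    refine HasDerivAt.fun_sum fun x _ => ?_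
    have := (((hasDerivAt_id (0 : ℝ)).mul_const (h x)).exp).const_mul (p x)
    simpa using this
  have hs := (hasDerivAt_iff_tendsto_slope.1 hd).eventually_lt_const hneg
  have hs' := hs.filter_mono (nhdsWithin_mono (0 : ℝ) (fun x (hx : x ∈ Set.Ioi 0) => ne_of_gt hx))
  obtain ⟨s, hs1, hs2⟩ := (hs'.and self_mem_nhdsWithin).exists
  refine ⟨s, hs2, ?_⟩
  have hs2' : (0 : ℝ) < s := hs2
  simp only [slope_def_field, zero_mul, Real.exp_zero, mul_one, hp1, sub_zero] at hs1
  rw [div_lt_iff₀ hs2', zero_mul] at hs1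
  linarith

theorem tendsto_sum_pi_of_mean_neg {α : Type*} [Fintype α] (p h : α → ℝ)
    (hp0 : ∀ x, 0 ≤ p x) (hp1 : ∑ x, p x = 1) (hneg : ∑ x, p x * h x < 0) :
    Filter.Tendsto (fun n => ∑ ω : Fin n → α, if 0 ≤ ∑ j, h (ω j) then ∏ j, p (ω j) else 0)
      Filter.atTop (nhds 0) := by
  obtain ⟨s, hs0, hs1⟩ := exists_pos_sum_mul_exp_lt_one p h hp1 hneg
  have hφ : 0 ≤ ∑ x, p x * Real.exp (s * h x) :=
    Finset.sum_nonneg fun x _ => mul_nonneg (hp0 x) (Real.exp_pos _).le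
  refine squeeze_zero (fun n => Finset.sum_nonneg fun ω _ => ?_) (fun n => ?_)
    (tendsto_pow_atTop_nhds_zero_of_lt_one hφ hs1)
  · split_ifs
    · exact Finset.prod_nonneg fun j _ => hp0 _
    · exact le_rfl
  · have : (∑ x, p x * Real.exp (s * h x)) ^ n =
        ∑ ω : Fin n → α, ∏ j, p (ω j) * Real.exp (s * h (ω j)) := by
      rw [← Fintype.piFinset_univ, ← Finset.prod_univ_sum (fun _ => (Finset.univ : Finset α))
        (fun _ x => p x * Real.exp (s * h x))]
      simp
    rw [this]
    refine Finset.sum_le_sum fun ω _ => ?_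
    rw [Finset.prod_mul_distrib, ← Real.exp_sum, ← Finset.mul_sum]
    have hP : 0 ≤ ∏ j, p (ω j) := Finset.prod_nonneg fun j _ => hp0 _
    split_ifs with h0
    · exact le_mul_of_one_le_right hP (Real.one_le_exp (mul_nonneg hs0.le h0))
    · exact mul_nonneg hP (Real.exp_pos _).le

/-! ### The `n`-letter source -/

/-- Sequences of tuples are tuples of sequences. -/
def unzipEquiv (M : Fin t → Type) (C : Type) (n : ℕ) :
    (Fin n → ((∀ i, M i) × C)) ≃ (∀ i, Fin n → M i) × (Fin n → C) where
  toFun ω := (fun i j => (ω j).1 i, fun j => (ω j).2)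
  invFun z j := (fun i => z.1 i j, z.2 j)
  left_inv _ := rfl
  right_inv _ := rfl

/-- The joint pmf of the message sequences and of `C([n])`. -/
def seqPmf (p : ((∀ i, M i) × C) → ℝ) (n : ℕ) (x : ∀ i, Fin n → M i) (c : Fin n → C) : ℝ :=
  ∏ j, p (fun i => x i j, c j)

theorem sum_sum_unzip (n : ℕ) (F : (∀ i, Fin n → M i) → (Fin n → C) → ℝ) :
    ∑ c, ∑ x, F x c =
      ∑ ω : Fin n → ((∀ i, M i) × C), F (fun i j => (ω j).1 i) (fun j => (ω j).2) := by
  rw [Finset.sum_comm, ← Fintype.sum_prod_type', ← (unzipEquiv M C n).sum_comp]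
  rfl

theorem Pind_eq (p : ((∀ i, M i) × C) → ℝ) (R : Fin t → ℝ) (n : ℕ)
    (𝔟 : ∀ i, (Fin n → M i) → Fin (nbins R n i))
    (c : Fin n → C) (mb : ∀ i, Fin (nbins R n i)) :
    Pind p R n 𝔟 c mb = ∑ x, if ∀ i, 𝔟 i (x i) = mb i then seqPmf p n x c else 0 := by
  have h := sum_sum_unzip (M := M) n (fun x c' =>
    if (∀ j, c' j = c j) ∧ ∀ i, 𝔟 i (x i) = mb i then seqPmf p n x c' else 0)
  refine h.symm.trans ?_
  rw [Finset.sum_comm]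
  refine Finset.sum_congr rfl fun x _ => ?_
  simp_rw [ite_and, ← funext_iff]
  simp

theorem sum_prod_swap {n : ℕ} (F : Fin n → (∀ i, M i) → ℝ) :
    ∑ x : ∀ i, Fin n → M i, ∏ j, F j (fun i => x i j) = ∏ j, ∑ m, F j m := by
  rw [Finset.prod_univ_sum, Fintype.piFinset_univ,
    ← (Equiv.piComm (fun (_ : Fin n) (i : Fin t) => M i)).sum_comp]
  rfl

theorem sum_seqPmf (p : ((∀ i, M i) × C) → ℝ) (n : ℕ) (c : Fin n → C) :
    ∑ x, seqPmf p n x c = ∏ j, pC p (c j) :=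
  sum_prod_swap fun j m => p (m, c j)

theorem sum_seqPmf_agree (p : ((∀ i, M i) × C) → ℝ) (n : ℕ) (U : Finset (Fin t))
    (x : ∀ i, Fin n → M i) (c : Fin n → C) :
    (∑ y, if ∀ i ∈ U, y i = x i then seqPmf p n y c else 0) =
      ∏ j, pSC p U (fun i => x i j) (c j) := by
  unfold pSC
  rw [← sum_prod_swap fun j m => if ∀ i : U, m i = x i j then p (m, c j) else 0]
  refine Finset.sum_congr rfl fun y _ => ?_
  rw [Finset.prod_ite_zero]
  congr 1
  simp only [funext_iff, Subtype.forall, Finset.mem_univ, true_implies]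
  exact propext ⟨fun h j i hi => h i hi j, fun h i hi j => h j i hi⟩

/-- The shifted information density `log p(m_U|c) + a log 2`, in nats. -/
def infoDensity (p : ((∀ i, M i) × C) → ℝ) (U : Finset (Fin t)) (a : ℝ)
    (z : (∀ i, M i) × C) : ℝ :=
  Real.log (pSC p U (fun i => z.1 i) z.2 / pC p z.2) + a * Real.log 2

theorem sum_mul_infoDensity (p : ((∀ i, M i) × C) → ℝ) (hp1 : ∑ x, p x = 1)
    (U : Finset (Fin t)) (a : ℝ) :
    ∑ z, p z * infoDensity p U a z = (a - condEnt p U) * Real.log 2 := by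
  have h1 : ∑ z : (∀ i, M i) × C, p z * Real.log (pSC p U (fun i => z.1 i) z.2 / pC p z.2) =
      ∑ f : ∀ i : U, M i.1, ∑ c : C, pSC p U f c * Real.log (pSC p U f c / pC p c) := by
    rw [Fintype.sum_prod_type_right]
    refine Eq.trans ?_ Finset.sum_comm
    refine Finset.sum_congr rfl fun c _ => ?_
    conv_rhs =>
      enter [2, f]
      rw [pSC, Finset.sum_mul]
    rw [Finset.sum_comm]
    refine Finset.sum_congr rfl fun m _ => ?_
    rw [Finset.sum_eq_single (fun i : U => m i)]
    · rw [if_pos fun _ => rfl]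
      rfl
    · intro f _ hf
      rw [if_neg, zero_mul]
      exact fun h => hf (funext fun i => (h i).symm)
    · simp
  have h2 : condEnt p U * Real.log 2 =
      -∑ f : ∀ i : U, M i.1, ∑ c : C, pSC p U f c * Real.log (pSC p U f c / pC p c) := by
    unfold condEnt Real.logb
    rw [neg_mul, Finset.sum_mul]
    refine congrArg _ (Finset.sum_congr rfl fun f _ => ?_)
    rw [Finset.sum_mul]
    refine Finset.sum_congr rfl fun c _ => ?_
    field_simp
  simp only [infoDensity, mul_add, Finset.sum_add_distrib]
  rw [h1, ← Finset.sum_mul, hp1]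
  linear_combination h2

theorem prod_pSC_le (p : ((∀ i, M i) × C) → ℝ) (hp0 : ∀ x, 0 ≤ p x) (U : Finset (Fin t)) (a : ℝ)
    (n : ℕ) (x : ∀ i, Fin n → M i) (c : Fin n → C) (hx : 0 < seqPmf p n x c)
    (h : ∑ j, infoDensity p U a (fun i => x i j, c j) < 0) :
    ∏ j, pSC p U (fun i => x i j) (c j) ≤ (2 : ℝ) ^ (-(n * a)) * ∏ j, pC p (c j) := by
  have hpj : ∀ j, 0 < p (fun i => x i j, c j) := fun j =>
    (hp0 _).lt_of_ne' (Finset.prod_ne_zero_iff.1 hx.ne' j (Finset.mem_univ j))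
  have hS : ∀ j, 0 < pSC p U (fun i => x i j) (c j) := fun j => by
    refine (hpj j).trans_le ?_
    have := Finset.single_le_sum
      (f := fun m => if ∀ i : U, m i.1 = x i j then p (m, c j) else 0)
      (fun m _ => by split_ifs <;> simp [hp0]) (Finset.mem_univ (fun i => x i j))
    simpa [pSC] using this
  have hC : ∀ j, 0 < pC p (c j) := fun j =>
    (hpj j).trans_le (Finset.single_le_sum (f := fun m => p (m, c j)) (fun m _ => hp0 _)
      (Finset.mem_univ (fun i => x i j)))
  have hCp : 0 < ∏ j, pC p (c j) := Finset.prod_pos fun j _ => hC j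
  rw [← div_le_iff₀ hCp, ← Finset.prod_div_distrib,
    ← Real.log_le_log_iff (Finset.prod_pos fun j _ => div_pos (hS j) (hC j)) (by positivity),
    Real.log_rpow two_pos, Real.log_prod fun j _ => (div_pos (hS j) (hC j)).ne']
  simp only [infoDensity, Finset.sum_add_distrib, Finset.sum_const, Finset.card_univ,
    Fintype.card_fin, nsmul_eq_mul] at h
  linarith

theorem nbins_pos (R : Fin t → ℝ) (n : ℕ) (i : Fin t) : 0 < nbins R n i :=
  Nat.ceil_pos.2 (by positivity)

theorem nbins_le (R : Fin t → ℝ) (hR : ∀ i, 0 < R i) (n : ℕ) (i : Fin t) :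
    (nbins R n i : ℝ) ≤ 2 * (2 : ℝ) ^ ((n : ℝ) * R i) := by
  have h1 : (1 : ℝ) ≤ (2 : ℝ) ^ ((n : ℝ) * R i) :=
    Real.one_le_rpow one_le_two (mul_nonneg n.cast_nonneg (hR i).le)
  have h2 := (Nat.ceil_lt_add_one (zero_le_one.trans h1)).le
  unfold nbins
  linarith

theorem tendsto_prod_nbins_mul (R : Fin t → ℝ) (hR : ∀ i, 0 < R i) (U : Finset (Fin t)) (a : ℝ)
    (ha : ∑ i ∈ U, R i < a) :
    Filter.Tendsto (fun n : ℕ => (∏ i ∈ U, (nbins R n i : ℝ)) * (2 : ℝ) ^ (-(n * a)))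
      Filter.atTop (nhds 0) := by
  have hlt : (2 : ℝ) ^ (∑ i ∈ U, R i - a) < 1 :=
    Real.rpow_lt_one_of_one_lt_of_neg one_lt_two (by linarith)
  have hlim := (tendsto_pow_atTop_nhds_zero_of_lt_one (by positivity) hlt).const_mul
    ((2 : ℝ) ^ U.card)
  rw [mul_zero] at hlim
  refine squeeze_zero (fun n => by positivity) (fun n => ?_) hlim
  calc (∏ i ∈ U, (nbins R n i : ℝ)) * (2 : ℝ) ^ (-(n * a))
      ≤ (∏ i ∈ U, 2 * (2 : ℝ) ^ ((n : ℝ) * R i)) * (2 : ℝ) ^ (-(n * a)) := by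
        gcongr with i _
        exact nbins_le R hR n i
    _ = (2 : ℝ) ^ U.card * ((2 : ℝ) ^ (∑ i ∈ U, R i - a)) ^ n := by
        rw [Finset.prod_mul_distrib, Finset.prod_const, ← Real.rpow_sum_of_pos two_pos,
          ← Finset.mul_sum, mul_assoc, ← Real.rpow_add two_pos, ← Real.rpow_mul_natCast two_pos.le]
        congr 2
        ring

theorem Ebin_le (p : ((∀ i, M i) × C) → ℝ) (hp0 : ∀ x, 0 ≤ p x) (hp1 : ∑ x, p x = 1)
    (R : Fin t → ℝ) (a : Finset (Fin t) → ℝ) (n : ℕ) :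
    Ebin p R n ≤
      (∑ U : Finset (Fin t) with U.Nonempty, ∑ ω : Fin n → ((∀ i, M i) × C),
        if 0 ≤ ∑ j, infoDensity p U (a U) (ω j) then ∏ j, p (ω j) else 0) +
      2⁻¹ * √(∑ U : Finset (Fin t) with U.Nonempty,
        (∏ i ∈ U, (nbins R n i : ℝ)) * (2 : ℝ) ^ (-(n * a U))) := by
  have hne : ∀ i, Nonempty (Fin (nbins R n i)) := fun i => ⟨⟨0, nbins_pos R n i⟩⟩
  have hq : ∀ x c, 0 ≤ seqPmf p n x c := fun x c => Finset.prod_nonneg fun j _ => hp0 _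
  set good : (∀ i, Fin n → M i) → (Fin n → C) → Prop := fun x c =>
    ∀ U : Finset (Fin t), U.Nonempty → ∑ j, infoDensity p U (a U) (fun i => x i j, c j) < 0
    with hgood
  let _ : ∀ x c, Decidable (good x c) := fun _ _ => Classical.propDecidable _
  have key := avg_tv_bin_le (K := fun i => Fin (nbins R n i)) (seqPmf p n) hq good
    (fun U => (2 : ℝ) ^ (-(n * a U))) (fun U => by positivity) (fun U hU x c hg hx => by
      have h := prod_pSC_le p hp0 U (a U) n x c hx (hg U hU)
      rw [← sum_seqPmf_agree, ← sum_seqPmf] at h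
      convert h)
  have hmass : ∑ c, ∑ x, seqPmf p n x c = 1 := by
    rw [sum_sum_unzip]
    have : ∑ ω : Fin n → ((∀ i, M i) × C), ∏ j, p (ω j) = (∑ z, p z) ^ n := by
      rw [← Fintype.piFinset_univ, ← Finset.prod_univ_sum
        (fun _ => (Finset.univ : Finset ((∀ i, M i) × C))) (fun _ z => p z)]
      simp
    rw [hp1, one_pow] at this
    exact this
  rw [hmass, mul_one] at key
  simp only [Fintype.card_fin] at key
  have hE : Ebin p R n ≤ (∑ c, ∑ x, if good x c then 0 else seqPmf p n x c) +
      2⁻¹ * √(∑ U : Finset (Fin t) with U.Nonempty,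
        (∏ i ∈ U, (nbins R n i : ℝ)) * (2 : ℝ) ^ (-(n * a U))) := by
    refine le_trans (le_of_eq ?_) key
    unfold Ebin Qideal
    simp_rw [Pind_eq, sum_seqPmf]
    congr!
  refine hE.trans (add_le_add ?_ le_rfl)
  rw [sum_sum_unzip, Finset.sum_comm]
  refine Finset.sum_le_sum fun ω _ => ?_
  have hP : 0 ≤ ∏ j, p (ω j) := Finset.prod_nonneg fun j _ => hp0 _
  have hnn : ∀ U ∈ Finset.univ.filter (fun U : Finset (Fin t) => U.Nonempty), 0 ≤
      if 0 ≤ ∑ j, infoDensity p U (a U) (ω j) then ∏ j, p (ω j) else 0 := fun U _ => by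
    split_ifs
    · exact hP
    · exact le_rfl
  split_ifs with hg
  · exact Finset.sum_nonneg hnn
  · simp only [hgood, not_forall, not_lt] at hg
    obtain ⟨U, hU, h⟩ := hg
    have := Finset.single_le_sum hnn (Finset.mem_filter.2 ⟨Finset.mem_univ U, hU⟩)
    rw [if_pos h] at this
    exact this

/-- **OSRB theorem.** If `∑_{i∈S} Rᵢ < H(M_S | C)` for every nonempty
`S ⊆ [t]`, then the expected total variation distance between the induced pmf of
`(C([n]), M̄₁, …, M̄_t)` and the ideal pmf tends to `0` as `n → ∞`. -/
theorem osrb (p : ((∀ i, M i) × C) → ℝ)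
    (hp0 : ∀ x, 0 ≤ p x) (hp1 : ∑ x, p x = 1)
    (R : Fin t → ℝ) (hR : ∀ i, 0 < R i)
    (hrate : ∀ S : Finset (Fin t), S.Nonempty → ∑ i ∈ S, R i < condEnt p S) :
    Filter.Tendsto (fun n => Ebin p R n) Filter.atTop (nhds 0) := by
  set a : Finset (Fin t) → ℝ := fun U => (∑ i ∈ U, R i + condEnt p U) / 2 with ha
  have h0 : ∀ n, 0 ≤ Ebin p R n := fun n =>
    mul_nonneg (inv_nonneg.2 (Nat.cast_nonneg _)) (Finset.sum_nonneg fun b _ =>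
      mul_nonneg (by norm_num) (Finset.sum_nonneg fun c _ => Finset.sum_nonneg fun k _ =>
        abs_nonneg _))
  refine squeeze_zero h0 (fun n => Ebin_le p hp0 hp1 R a n) ?_
  have hbad := tendsto_finsetSum (Finset.univ.filter fun U : Finset (Fin t) => U.Nonempty)
    fun U hU => tendsto_sum_pi_of_mean_neg p (infoDensity p U (a U)) hp0 hp1 (by
      rw [sum_mul_infoDensity p hp1]
      have := hrate U (Finset.mem_filter.1 hU).2
      exact mul_neg_of_neg_of_pos (by simp only [ha]; linarith) (Real.log_pos one_lt_two))
  have hvar := tendsto_finsetSum (Finset.univ.filter fun U : Finset (Fin t) => U.Nonempty)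
    fun U hU => tendsto_prod_nbins_mul R hR U (a U) (by
      have := hrate U (Finset.mem_filter.1 hU).2
      simp only [ha]
      linarith)
  have hsqrt := ((Real.continuous_sqrt.tendsto _).comp hvar).const_mul 2⁻¹
  have := hbad.add hsqrt
  simp only [Finset.sum_const_zero, Real.sqrt_zero, mul_zero, add_zero] at this
  exact this

end OSRB
end
end

section
/- (Linear OSRB.) Let F be a finite field, let Mᵢ take values in F^{ℓᵢ} for i ∈ [t], and let (M₁, …, M_t, C) be random variables with joint pmf p, C taking values in a finite set 𝒞. Let (M₁([n]), …, M_t([n]), C([n])) denote n i.i.d. copies, and view Mᵢ([n]) as a vector in F^{nℓᵢ}. Fix rates R₁, …, R_t > 0, let bᵢ = ⌊nRᵢ / log₂|F|⌋, and define the linear random binning M̄ᵢ = Aᵢ·Mᵢ([n]) + Vᵢ ∈ F^{bᵢ}, where the matrices Aᵢ ∈ F^{bᵢ × nℓᵢ} and vectors Vᵢ ∈ F^{bᵢ} have mutually independent entries, each uniform on F. Let P denote the joint pmf of (C([n]), M̄₁, …, M̄_t) induced by a fixed realization of (Aᵢ, Vᵢ). If for every nonempty subset S ⊆ [t] it holds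 that ∑_{i∈S} Rᵢ < H(M_S | C), then lim_{n→∞} 𝔼 ‖ P_{C([n]), M̄₁,…,M̄_t} − p_{C([n])} ⊗ ∏_{i=1}^t p^U_{F^{bᵢ}} ‖₁ = 0, where the expectation is over the random matrices and vectors and p^U_S denotes the uniform pmf on S. -/
open Finset

noncomputable section

namespace LinOSRB

variable {F : Type} [Field F] [Fintype F] [DecidableEq F]
  {t : ℕ} {ℓ : Fin t → ℕ} {C : Type} [Fintype C] [DecidableEq C]

/-- Marginal pmf of `C`. -/
def pC (p : ((∀ i, Fin (ℓ i) → F) × C) → ℝ) (c : C) : ℝ :=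
  ∑ m : ∀ i, Fin (ℓ i) → F, p (m, c)

/-- Joint pmf of `(M_S, C)` for a subset `S` of the messages. -/
def pSC (p : ((∀ i, Fin (ℓ i) → F) × C) → ℝ) (S : Finset (Fin t))
    (f : ∀ i : S, Fin (ℓ i.1) → F) (c : C) : ℝ :=
  ∑ m : ∀ i, Fin (ℓ i) → F, if ∀ i : S, m i.1 = f i then p (m, c) else 0

/-- Conditional entropy `H(M_S | C)` in bits. -/
def condEnt (p : ((∀ i, Fin (ℓ i) → F) × C) → ℝ) (S : Finset (Fin t)) : ℝ :=
  - ∑ f : ∀ i : S, Fin (ℓ i.1) → F, ∑ c : C,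
      pSC p S f c * Real.logb 2 (pSC p S f c / pC p c)

/-- The bin-index length `bᵢ = ⌊nRᵢ / log₂ q⌋` (with `q = |F|`). -/
def nb (q : ℕ) (R : Fin t → ℝ) (n : ℕ) (i : Fin t) : ℕ :=
  ⌊(n : ℝ) * R i / Real.logb 2 q⌋₊

/-- The pmf of `(C([n]), M̄₁, …, M̄_t)` induced by a fixed realization
`AV = (Aᵢ, Vᵢ)ᵢ` of the affine linear binnings `M̄ᵢ = Aᵢ·Mᵢ([n]) + Vᵢ`, where the
underlying source is `n` i.i.d. copies of `(M₁, …, M_t, C) ∼ p` and `Mᵢ([n])` is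
viewed as a vector indexed by `Fin n × Fin ℓᵢ`. -/
def PindL (p : ((∀ i, Fin (ℓ i) → F) × C) → ℝ) (R : Fin t → ℝ) (n : ℕ)
    (AV : ∀ i, Matrix (Fin (nb (Fintype.card F) R n i)) (Fin n × Fin (ℓ i)) F ×
      (Fin (nb (Fintype.card F) R n i) → F))
    (c : Fin n → C) (mb : ∀ i, Fin (nb (Fintype.card F) R n i) → F) : ℝ :=
  ∑ ω : Fin n → ((∀ i, Fin (ℓ i) → F) × C),
    if (∀ j, (ω j).2 = c j) ∧
       (∀ i, (AV i).1.mulVec (fun q => (ω q.1).1 i q.2) + (AV i).2 = mb i)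
    then ∏ j, p (ω j) else 0

/-- The ideal pmf `p_{C([n])} ⊗ ∏ᵢ p^U_{F^{bᵢ}}`. -/
def QidealL (p : ((∀ i, Fin (ℓ i) → F) × C) → ℝ) (R : Fin t → ℝ) (n : ℕ)
    (c : Fin n → C) (_mb : ∀ i, Fin (nb (Fintype.card F) R n i) → F) : ℝ :=
  (∏ j, pC p (c j)) *
    ∏ i, (Fintype.card (Fin (nb (Fintype.card F) R n i) → F) : ℝ)⁻¹

/-- The expected total variation distance, averaged over all matrices `Aᵢ` and
vectors `Vᵢ` with mutually independent entries, each uniform on `F`. -/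
def EbinL (p : ((∀ i, Fin (ℓ i) → F) × C) → ℝ) (R : Fin t → ℝ) (n : ℕ) : ℝ :=
  (Fintype.card (∀ i, Matrix (Fin (nb (Fintype.card F) R n i)) (Fin n × Fin (ℓ i)) F ×
      (Fin (nb (Fintype.card F) R n i) → F)) : ℝ)⁻¹ *
    ∑ AV : ∀ i, Matrix (Fin (nb (Fintype.card F) R n i)) (Fin n × Fin (ℓ i)) F ×
        (Fin (nb (Fintype.card F) R n i) → F),
      2⁻¹ * ∑ c : Fin n → C, ∑ mb : ∀ i, Fin (nb (Fintype.card F) R n i) → F,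
        |PindL p R n AV c mb - QidealL p R n c mb|

/-- If `W` has negative mean, its moment generating function is less than `1` somewhere on the
positive half-line. -/
theorem exists_pos_sum_mul_exp_lt_one {Ω : Type*} [Fintype Ω] (p W : Ω → ℝ)
    (hp1 : ∑ x, p x = 1) (hW : ∑ x, p x * W x < 0) :
    ∃ s : ℝ, 0 < s ∧ ∑ x, p x * Real.exp (s * W x) < 1 := by
  have hd : HasDerivAt (fun s : ℝ => ∑ x, p x * Real.exp (s * W x)) (∑ x, p x * W x) 0 := by
    refine HasDerivAt.fun_sum fun x _ => ?_
    have := (((hasDerivAt_id (0 : ℝ)).mul_const (W x)).exp).const_mul (p x)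
    simpa using this
  rw [hasDerivAt_iff_tendsto_slope] at hd
  have hev := (hd.eventually (gt_mem_nhds hW)).filter_mono
    (nhdsWithin_mono 0 fun x (hx : x ∈ Set.Ioi (0 : ℝ)) => ne_of_gt hx)
  obtain ⟨s, hs, hs0⟩ := (hev.and self_mem_nhdsWithin).exists
  refine ⟨s, hs0, ?_⟩
  have hs0' : 0 < s := hs0
  rw [slope_def_field, sub_zero, div_lt_iff₀ hs0'] at hs
  simpa [hp1] using hs

/-- Chernoff bound for the event that a product of i.i.d. likelihood ratios `u / v` exceeds
`exp (-b) ^ n`. -/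
theorem sum_ite_prod_le_pow {Ω : Type*} [Fintype Ω] (p u v : Ω → ℝ)
    (hp0 : ∀ x, 0 ≤ p x)
    (hu : ∀ x, 0 < p x → 0 < u x) (hv : ∀ x, 0 < p x → 0 < v x) (b s : ℝ) (hs : 0 < s) (n : ℕ) :
    (∑ ω : Fin n → Ω, if Real.exp (-b) ^ n * ∏ j, v (ω j) < ∏ j, u (ω j)
        then ∏ j, p (ω j) else 0) ≤
      (∑ x, p x * Real.exp (s * (Real.log (u x / v x) + b))) ^ n := by
  rw [Fintype.sum_pow]
  refine Finset.sum_le_sum fun ω _ => ?_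
  have hnn : 0 ≤ ∏ j, p (ω j) * Real.exp (s * (Real.log (u (ω j) / v (ω j)) + b)) :=
    Finset.prod_nonneg fun j _ => mul_nonneg (hp0 _) (Real.exp_pos _).le
  split_ifs with h
  swap
  · exact hnn
  by_cases hz : ∃ j, p (ω j) = 0
  · obtain ⟨j, hj⟩ := hz
    rwa [Finset.prod_eq_zero (Finset.mem_univ j) hj]
  push Not at hz
  have hpos : ∀ j, 0 < p (ω j) := fun j => lt_of_le_of_ne (hp0 _) (hz j).symm
  rw [Finset.prod_mul_distrib, ← Real.exp_sum, ← Finset.mul_sum]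
  refine le_mul_of_one_le_right (Finset.prod_nonneg fun j _ => hp0 _) (Real.one_le_exp ?_)
  refine mul_nonneg hs.le ?_
  have hvpos : 0 < ∏ j, v (ω j) := Finset.prod_pos fun j _ => hv _ (hpos j)
  have hexp : Real.exp (∑ j, (Real.log (u (ω j) / v (ω j)) + b)) =
      (∏ j, u (ω j)) / (∏ j, v (ω j)) / Real.exp (-b) ^ n := by
    rw [Real.exp_sum, ← Finset.prod_div_distrib]
    simp_rw [Real.exp_add]
    rw [Finset.prod_mul_distrib, Real.exp_neg]
    simp only [Finset.prod_const, Finset.card_univ, Fintype.card_fin, inv_pow, div_inv_eq_mul]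
    congr 1
    exact Finset.prod_congr rfl fun j _ =>
      Real.exp_log (div_pos (hu _ (hpos j)) (hv _ (hpos j)))
  rw [← Real.one_le_exp_iff, hexp, div_div, one_le_div (by positivity), mul_comm]
  exact h.le

/-- Jensen's inequality for the uniform average of an absolute value. -/
theorem inv_card_mul_sum_abs_le_sqrt {K : Type*} [Fintype K] (g : K → ℝ) :
    (Fintype.card K : ℝ)⁻¹ * ∑ k, |g k| ≤ √((Fintype.card K : ℝ)⁻¹ * ∑ k, g k ^ 2) := by
  refine Real.le_sqrt_of_sq_le ?_
  have h := sq_sum_le_card_mul_sum_sq (s := (Finset.univ : Finset K)) (f := fun k => |g k|)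
  simp only [sq_abs, Finset.card_univ] at h
  calc ((Fintype.card K : ℝ)⁻¹ * ∑ k, |g k|) ^ 2
      = (Fintype.card K : ℝ)⁻¹ ^ 2 * (∑ k, |g k|) ^ 2 := mul_pow _ _ _
    _ ≤ (Fintype.card K : ℝ)⁻¹ ^ 2 * (Fintype.card K * ∑ k, g k ^ 2) := by gcongr
    _ = (Fintype.card K : ℝ)⁻¹ * ∑ k, g k ^ 2 := by
      rcases eq_or_ne (Fintype.card K : ℝ) 0 with h0 | h0
      · simp [h0]
      · field_simp

/-- Uniform averages commute with finite linear combinations. -/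
theorem inv_card_mul_sum_sum {K Ω : Type*} [Fintype K] [Fintype Ω] (a : Ω → ℝ)
    (I : K → Ω → ℝ) :
    (Fintype.card K : ℝ)⁻¹ * ∑ k, ∑ ω, a ω * I k ω =
      ∑ ω, a ω * ((Fintype.card K : ℝ)⁻¹ * ∑ k, I k ω) := by
  rw [Finset.sum_comm, Finset.mul_sum]
  refine Finset.sum_congr rfl fun ω _ => ?_
  rw [← Finset.mul_sum]
  ring

theorem inv_card_mul_sum_const_le {K : Type*} [Fintype K] {y : ℝ} (hy : 0 ≤ y) :
    (Fintype.card K : ℝ)⁻¹ * ∑ _k : K, y ≤ y := by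
  rw [Finset.sum_const, Finset.card_univ, nsmul_eq_mul, ← mul_assoc]
  exact mul_le_of_le_one_left hy inv_mul_le_one

/-- Second-moment bound on the mean deviation of a randomly weighted sum. -/
theorem mean_deviation_le_sqrt {K Ω : Type*} [Fintype K] [Fintype Ω] (a : Ω → ℝ)
    (ha : ∀ ω, 0 ≤ a ω) (I : K → Ω → ℝ) (κ : Ω → Ω → ℝ) (β : ℝ) (hβ : 0 ≤ β)
    (hI : ∀ ω, (Fintype.card K : ℝ)⁻¹ * ∑ k, I k ω = β)
    (hII : ∀ ω ω', (Fintype.card K : ℝ)⁻¹ * ∑ k, I k ω * I k ω' ≤ β ^ 2 * (1 + κ ω ω')) :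
    (Fintype.card K : ℝ)⁻¹ * ∑ k, |(∑ ω, a ω * I k ω) - (∑ ω, a ω) * β| ≤
      β * √(∑ ω, ∑ ω', a ω * (a ω' * κ ω ω')) := by
  refine (inv_card_mul_sum_abs_le_sqrt _).trans ?_
  nth_rewrite 2 [← Real.sqrt_sq hβ]
  rw [← Real.sqrt_mul (sq_nonneg β)]
  refine Real.sqrt_le_sqrt ?_
  set A := ∑ ω, a ω with hA
  have h1 : (Fintype.card K : ℝ)⁻¹ * ∑ k, ∑ ω, a ω * I k ω = A * β := by
    rw [inv_card_mul_sum_sum, hA, Finset.sum_mul]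
    simp_rw [hI]
  have h2 : (Fintype.card K : ℝ)⁻¹ * ∑ k, (∑ ω, a ω * I k ω) ^ 2 ≤
      β ^ 2 * (A ^ 2 + ∑ ω, ∑ ω', a ω * (a ω' * κ ω ω')) := by
    have e : ∀ k, (∑ ω, a ω * I k ω) ^ 2 =
        ∑ q : Ω × Ω, (a q.1 * a q.2) * (I k q.1 * I k q.2) := fun k => by
      rw [sq, Finset.sum_mul_sum, Fintype.sum_prod_type]
      exact Finset.sum_congr rfl fun _ _ => Finset.sum_congr rfl fun _ _ => by ring
    simp_rw [e]
    rw [inv_card_mul_sum_sum (fun q : Ω × Ω => a q.1 * a q.2) fun k q => I k q.1 * I k q.2]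
    refine (Finset.sum_le_sum fun q _ => mul_le_mul_of_nonneg_left (hII q.1 q.2)
      (mul_nonneg (ha q.1) (ha q.2))).trans_eq ?_
    rw [Fintype.sum_prod_type, sq A, hA, Finset.sum_mul_sum, ← Finset.sum_add_distrib,
      Finset.mul_sum]
    refine Finset.sum_congr rfl fun ω _ => ?_
    rw [← Finset.sum_add_distrib, Finset.mul_sum]
    exact Finset.sum_congr rfl fun _ _ => by ring
  have h3 := inv_card_mul_sum_const_le (K := K) (sq_nonneg (A * β))
  have e : (Fintype.card K : ℝ)⁻¹ * ∑ k, ((∑ ω, a ω * I k ω) - A * β) ^ 2 =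
      (Fintype.card K : ℝ)⁻¹ * ∑ k, (∑ ω, a ω * I k ω) ^ 2 -
      2 * (A * β) * ((Fintype.card K : ℝ)⁻¹ * ∑ k, ∑ ω, a ω * I k ω) +
      (Fintype.card K : ℝ)⁻¹ * ∑ _k : K, (A * β) ^ 2 := by
    simp_rw [sub_sq, Finset.sum_add_distrib, Finset.sum_sub_distrib, ← Finset.sum_mul,
      ← Finset.mul_sum]
    ring
  rw [e, h1]
  nlinarith

/-- Trivial bound on the mean deviation of a randomly weighted sum. -/
theorem mean_deviation_le_two_mul {K Ω : Type*} [Fintype K] [Fintype Ω] (a : Ω → ℝ)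
    (ha : ∀ ω, 0 ≤ a ω) (I : K → Ω → ℝ) (hI0 : ∀ k ω, 0 ≤ I k ω) (β : ℝ) (hβ : 0 ≤ β)
    (hI : ∀ ω, (Fintype.card K : ℝ)⁻¹ * ∑ k, I k ω = β) :
    (Fintype.card K : ℝ)⁻¹ * ∑ k, |(∑ ω, a ω * I k ω) - (∑ ω, a ω) * β| ≤
      2 * ((∑ ω, a ω) * β) := by
  have hA : 0 ≤ (∑ ω, a ω) * β := mul_nonneg (Finset.sum_nonneg fun ω _ => ha ω) hβ
  have h1 : (Fintype.card K : ℝ)⁻¹ * ∑ k, ∑ ω, a ω * I k ω = (∑ ω, a ω) * β := by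
    rw [inv_card_mul_sum_sum, Finset.sum_mul]
    simp_rw [hI]
  calc (Fintype.card K : ℝ)⁻¹ * ∑ k, |(∑ ω, a ω * I k ω) - (∑ ω, a ω) * β|
      ≤ (Fintype.card K : ℝ)⁻¹ * ∑ k, ((∑ ω, a ω * I k ω) + (∑ ω, a ω) * β) := by
        gcongr with k
        have hX : 0 ≤ ∑ ω, a ω * I k ω :=
          Finset.sum_nonneg fun ω _ => mul_nonneg (ha ω) (hI0 k ω)
        rw [abs_le]
        constructor <;> linarith
    _ ≤ 2 * ((∑ ω, a ω) * β) := by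
        rw [Finset.sum_add_distrib, mul_add, h1, two_mul]
        exact add_le_add_right (inv_card_mul_sum_const_le hA) _

/-- One-shot random binning. If under a uniformly random map `f k` every point is uniformly
distributed over the bins, and two points collide with probability exceeding that of independent
uniform bins by a controlled amount `κ` on average over the good set `T`, then the expected total
variation distance to the ideal pmf is small. -/
theorem expected_tv_le {K Ω 𝒞 B : Type*} [Fintype K] [Fintype Ω] [Fintype 𝒞] [Fintype B]
    [DecidableEq 𝒞] [DecidableEq B]
    (w : Ω → ℝ) (hw0 : ∀ ω, 0 ≤ w ω) (hw1 : ∑ ω, w ω = 1) (c : Ω → 𝒞) (f : K → Ω → B)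
    (T : Ω → Prop) [DecidablePred T] (κ : Ω → Ω → ℝ) (hκ : ∀ ω ω', 0 ≤ κ ω ω')
    (δ : ℝ) (hδ : 0 ≤ δ)
    (hunif : ∀ ω b, (Fintype.card K : ℝ)⁻¹ * ∑ k, (if f k ω = b then (1 : ℝ) else 0) =
      (Fintype.card B : ℝ)⁻¹)
    (hpair : ∀ ω ω' b, (Fintype.card K : ℝ)⁻¹ *
        ∑ k, ((if f k ω = b then (1 : ℝ) else 0) * if f k ω' = b then (1 : ℝ) else 0) ≤
      (Fintype.card B : ℝ)⁻¹ ^ 2 * (1 + κ ω ω'))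
    (hT : ∀ ω, T ω → ∑ ω', (if c ω' = c ω then w ω' * κ ω ω' else 0) ≤
      δ * ∑ ω', if c ω' = c ω then w ω' else 0) :
    (Fintype.card K : ℝ)⁻¹ * ∑ k, 2⁻¹ * ∑ x, ∑ b,
        |(∑ ω, if c ω = x ∧ f k ω = b then w ω else 0) -
          (∑ ω, if c ω = x then w ω else 0) * (Fintype.card B : ℝ)⁻¹| ≤
      2⁻¹ * √δ + ∑ ω, if T ω then 0 else w ω := by
  set β := (Fintype.card B : ℝ)⁻¹ with hβ
  have hβ0 : 0 ≤ β := by positivity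
  let pc : 𝒞 → ℝ := fun x => ∑ ω, if c ω = x then w ω else 0
  let a : 𝒞 → Ω → ℝ := fun x ω => if c ω = x ∧ T ω then w ω else 0
  let a' : 𝒞 → Ω → ℝ := fun x ω => if c ω = x ∧ ¬ T ω then w ω else 0
  let I : B → K → Ω → ℝ := fun b k ω => if f k ω = b then 1 else 0
  have hpc0 : ∀ x, 0 ≤ pc x := fun x => Finset.sum_nonneg fun ω _ => by
    split_ifs <;> simp [hw0]
  have ha : ∀ x ω, 0 ≤ a x ω := fun x ω => by
    simp only [a]; split_ifs <;> simp [hw0]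
  have ha' : ∀ x ω, 0 ≤ a' x ω := fun x ω => by
    simp only [a']; split_ifs <;> simp [hw0]
  have hale : ∀ x ω, a x ω ≤ if c ω = x then w ω else 0 := fun x ω => by
    by_cases h1 : c ω = x <;> by_cases h2 : T ω <;> simp [a, h1, h2, hw0]
  have hI0 : ∀ b k ω, 0 ≤ I b k ω := fun b k ω => by
    simp only [I]; split_ifs <;> simp
  have hgood : ∀ x, √(∑ ω, ∑ ω', a x ω * (a x ω' * κ ω ω')) ≤ √δ * pc x := fun x => by
    rw [← Real.sqrt_sq (hpc0 x), ← Real.sqrt_mul hδ]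
    refine Real.sqrt_le_sqrt ?_
    calc ∑ ω, ∑ ω', a x ω * (a x ω' * κ ω ω') ≤ ∑ ω, a x ω * (δ * pc x) := by
          refine Finset.sum_le_sum fun ω _ => ?_
          rw [← Finset.mul_sum]
          by_cases h : c ω = x ∧ T ω
          · refine mul_le_mul_of_nonneg_left ?_ (ha x ω)
            have := hT ω h.2
            rw [h.1] at this
            refine le_trans (Finset.sum_le_sum fun ω' _ => ?_) this
            have := mul_le_mul_of_nonneg_right (hale x ω') (hκ ω ω')
            exact this.trans_eq (by rw [ite_mul, zero_mul])
          · simp [a, h]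
      _ ≤ pc x * (δ * pc x) := by
          rw [← Finset.sum_mul]
          exact mul_le_mul_of_nonneg_right (Finset.sum_le_sum fun ω _ => hale x ω)
            (mul_nonneg hδ (hpc0 x))
      _ = δ * pc x ^ 2 := by ring
  have hxb : ∀ x b, (Fintype.card K : ℝ)⁻¹ * ∑ k,
      |(∑ ω, if c ω = x ∧ f k ω = b then w ω else 0) - pc x * β| ≤
      β * (√δ * pc x + 2 * ∑ ω, a' x ω) := fun x b => by
    have hsplit : ∀ ω, (if c ω = x then w ω else 0) = a x ω + a' x ω := fun ω => by
      by_cases h1 : c ω = x <;> by_cases h2 : T ω <;> simp [a, a', h1, h2]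
    have e1 : pc x = (∑ ω, a x ω) + ∑ ω, a' x ω := by
      rw [← Finset.sum_add_distrib]
      exact Finset.sum_congr rfl fun ω _ => hsplit ω
    have e2 : ∀ k, (∑ ω, if c ω = x ∧ f k ω = b then w ω else 0) =
        (∑ ω, a x ω * I b k ω) + ∑ ω, a' x ω * I b k ω := fun k => by
      rw [← Finset.sum_add_distrib]
      refine Finset.sum_congr rfl fun ω _ => ?_
      rw [← add_mul, ← hsplit]
      by_cases h1 : c ω = x <;> by_cases h2 : f k ω = b <;> simp [I, h1, h2]
    have h1 := mean_deviation_le_sqrt (a x) (ha x) (I b) κ β hβ0 (fun ω => hunif ω b)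
      fun ω ω' => hpair ω ω' b
    have h2 := mean_deviation_le_two_mul (a' x) (ha' x) (I b) (hI0 b) β hβ0 fun ω => hunif ω b
    have h3 := mul_le_mul_of_nonneg_left (hgood x) hβ0
    calc _ ≤ (Fintype.card K : ℝ)⁻¹ * ∑ k, (|(∑ ω, a x ω * I b k ω) - (∑ ω, a x ω) * β| +
            |(∑ ω, a' x ω * I b k ω) - (∑ ω, a' x ω) * β|) := by
          gcongr with k
          rw [e1, e2, add_mul, add_sub_add_comm]
          exact abs_add_le _ _
      _ ≤ _ := by
          rw [Finset.sum_add_distrib, mul_add]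
          linarith
  have hswap : (Fintype.card K : ℝ)⁻¹ * ∑ k, 2⁻¹ * ∑ x, ∑ b,
        |(∑ ω, if c ω = x ∧ f k ω = b then w ω else 0) - pc x * β| =
      2⁻¹ * ∑ x, ∑ b, (Fintype.card K : ℝ)⁻¹ * ∑ k,
        |(∑ ω, if c ω = x ∧ f k ω = b then w ω else 0) - pc x * β| := by
    simp_rw [← Finset.mul_sum]
    rw [mul_left_comm, Finset.sum_comm]
    congr 2
    exact Finset.sum_congr rfl fun x _ => Finset.sum_comm
  refine hswap.trans_le ?_
  have hpc1 : ∑ x, pc x = 1 := by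
    simp only [pc]
    rw [Finset.sum_comm]
    simpa using hw1
  have ha1 : ∑ x, ∑ ω, a' x ω = ∑ ω, if T ω then 0 else w ω := by
    rw [Finset.sum_comm]
    refine Finset.sum_congr rfl fun ω _ => ?_
    by_cases h : T ω <;> simp [a', h]
  have hbad0 : 0 ≤ ∑ ω, if T ω then 0 else w ω :=
    Finset.sum_nonneg fun ω _ => by split_ifs <;> simp [hw0]
  calc _ ≤ 2⁻¹ * ∑ x, ∑ _b : B, β * (√δ * pc x + 2 * ∑ ω, a' x ω) := by
        exact mul_le_mul_of_nonneg_left (Finset.sum_le_sum fun x _ =>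
          Finset.sum_le_sum fun b _ => hxb x b) (by norm_num)
    _ = (Fintype.card B * β) * (2⁻¹ * √δ + ∑ ω, if T ω then 0 else w ω) := by
        simp only [Finset.sum_const, Finset.card_univ, nsmul_eq_mul]
        simp_rw [← Finset.mul_sum, Finset.sum_add_distrib, ← Finset.mul_sum]
        rw [hpc1, ha1]
        ring
    _ ≤ _ := mul_le_of_le_one_left (by positivity) mul_inv_le_one

/-- A surjective homomorphism of finite groups maps the uniform law to the uniform law. -/
theorem inv_card_mul_sum_ite_eq {K G : Type*} [AddGroup K] [Fintype K] [AddGroup G] [Fintype G]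
    [DecidableEq G] (φ : K →+ G) (hφ : Function.Surjective φ) (g : G) :
    (Fintype.card K : ℝ)⁻¹ * ∑ k, (if φ k = g then (1 : ℝ) else 0) =
      (Fintype.card G : ℝ)⁻¹ := by
  have hcard : Fintype.card K = Fintype.card G * #{k | φ k = g} := by
    rw [← Finset.card_univ (α := K), Finset.card_eq_sum_card_fiberwise (f := φ) (t := univ)
      (fun _ _ => Finset.mem_coe.2 (Finset.mem_univ _)),
      Finset.sum_congr rfl fun y _ => AddMonoidHom.card_fiber_eq_of_mem_range φ (hφ y) (hφ g)]
    simp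
  have h0 : (#{k | φ k = g} : ℝ) ≠ 0 := by
    have : 0 < Fintype.card K := Fintype.card_pos
    rw [hcard] at this
    exact_mod_cast (Nat.pos_of_mul_pos_left this).ne'
  rw [Finset.sum_boole, hcard, Nat.cast_mul, mul_inv, mul_assoc, inv_mul_cancel₀ h0, mul_one]

/-- Evaluation of a random affine map at a point, as a homomorphism in the random coefficients. -/
def affineEval {m N : Type*} [Fintype N] (x : N → F) :
    Matrix m N F × (m → F) →+ (m → F) where
  toFun k := k.1.mulVec x + k.2
  map_zero' := by simp
  map_add' k k' := by
    rw [Prod.fst_add, Prod.snd_add, Matrix.add_mulVec]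
    abel

theorem affineEval_surjective {m N : Type*} [Fintype N] (x : N → F) :
    Function.Surjective (affineEval (m := m) x) := fun y => ⟨(0, y), by simp [affineEval]⟩

theorem affineEval_prod_surjective {m N : Type*} [Fintype N] {x x' : N → F} (hx : x ≠ x') :
    Function.Surjective ((affineEval (m := m) x).prod (affineEval x')) := by
  classical
  rintro ⟨y, y'⟩
  obtain ⟨q, hq⟩ := Function.ne_iff.1 hx
  have hq' : x q - x' q ≠ 0 := sub_ne_zero.2 hq
  let A : Matrix m N F := fun i r => if r = q then (y i - y' i) / (x q - x' q) else 0
  have hA : ∀ z i, A.mulVec z i = (y i - y' i) / (x q - x' q) * z q := fun z i => by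
    simp [A, Matrix.mulVec, dotProduct]
  refine ⟨(A, y - A.mulVec x), Prod.ext ?_ ?_⟩
  · simp [affineEval]
  · funext i
    simp only [AddMonoidHom.prod_apply, affineEval, AddMonoidHom.coe_mk, ZeroHom.coe_mk,
      Pi.add_apply, Pi.sub_apply, hA]
    field_simp
    ring

/-- The probability that a product event holds under independent uniform choices. -/
theorem inv_card_mul_sum_ite_forall {ι : Type*} [Fintype ι] [DecidableEq ι] {K : ι → Type*}
    [∀ i, Fintype (K i)] (P : ∀ i, K i → Prop) [∀ i, DecidablePred (P i)]
    (Q : (∀ i, K i) → Prop) [DecidablePred Q] (hQ : ∀ k, Q k ↔ ∀ i, P i (k i)) :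
    (Fintype.card (∀ i, K i) : ℝ)⁻¹ * ∑ k : ∀ i, K i, (if Q k then (1 : ℝ) else 0) =
      ∏ i, ((Fintype.card (K i) : ℝ)⁻¹ * ∑ k, if P i k then (1 : ℝ) else 0) := by
  rw [Finset.prod_mul_distrib, Fintype.prod_sum, Fintype.card_pi, Nat.cast_prod,
    Finset.prod_inv_distrib]
  congr 1
  exact Finset.sum_congr rfl fun k _ => by
    rw [Finset.prod_boole]
    simp [hQ]

theorem affine_bins_uniform {N : Fin t → Type*} [∀ i, Fintype (N i)] [∀ i, DecidableEq (N i)]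
    (d : Fin t → ℕ) (x : ∀ i, N i → F) (b : ∀ i, Fin (d i) → F) :
    (Fintype.card (∀ i, Matrix (Fin (d i)) (N i) F × (Fin (d i) → F)) : ℝ)⁻¹ *
      ∑ k : ∀ i, Matrix (Fin (d i)) (N i) F × (Fin (d i) → F),
        (if (fun i => (k i).1.mulVec (x i) + (k i).2) = b then (1 : ℝ) else 0) =
      (Fintype.card (∀ i, Fin (d i) → F) : ℝ)⁻¹ := by
  rw [Fintype.card_pi (α := fun i => Fin (d i) → F), Nat.cast_prod, ← Finset.prod_inv_distrib]
  refine (inv_card_mul_sum_ite_forall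
    (K := fun i => Matrix (Fin (d i)) (N i) F × (Fin (d i) → F))
    (fun i k => k.1.mulVec (x i) + k.2 = b i) _ fun k => funext_iff).trans ?_
  exact Finset.prod_congr rfl fun i _ =>
    inv_card_mul_sum_ite_eq (affineEval (x i)) (affineEval_surjective _) (b i)

theorem affine_bins_collision {N : Fin t → Type*} [∀ i, Fintype (N i)] [∀ i, DecidableEq (N i)]
    (d : Fin t → ℕ) (x x' : ∀ i, N i → F) (b : ∀ i, Fin (d i) → F) :
    (Fintype.card (∀ i, Matrix (Fin (d i)) (N i) F × (Fin (d i) → F)) : ℝ)⁻¹ *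
      ∑ k : ∀ i, Matrix (Fin (d i)) (N i) F × (Fin (d i) → F),
        ((if (fun i => (k i).1.mulVec (x i) + (k i).2) = b then (1 : ℝ) else 0) *
          if (fun i => (k i).1.mulVec (x' i) + (k i).2) = b then (1 : ℝ) else 0) =
      (Fintype.card (∀ i, Fin (d i) → F) : ℝ)⁻¹ ^ 2 *
        ∏ i with x i = x' i, (Fintype.card (Fin (d i) → F) : ℝ) := by
  rw [Fintype.card_pi (α := fun i => Fin (d i) → F), Nat.cast_prod, ← Finset.prod_inv_distrib,
    ← Finset.prod_pow, Finset.prod_filter, ← Finset.prod_mul_distrib]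
  simp_rw [ite_zero_mul_ite_zero, mul_one]
  refine (inv_card_mul_sum_ite_forall
    (K := fun i => Matrix (Fin (d i)) (N i) F × (Fin (d i) → F))
    (fun i k => k.1.mulVec (x i) + k.2 = b i ∧ k.1.mulVec (x' i) + k.2 = b i) _
    fun k => by rw [funext_iff, funext_iff, forall_and]).trans ?_
  refine Finset.prod_congr rfl fun i _ => ?_
  by_cases h : x i = x' i
  · have h0 : (Fintype.card (Fin (d i) → F) : ℝ) ≠ 0 := by
      exact_mod_cast Fintype.card_ne_zero
    simp only [h, and_self, if_true]
    rw [sq, inv_mul_cancel_right₀ h0]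
    exact inv_card_mul_sum_ite_eq (affineEval (x' i)) (affineEval_surjective _) (b i)
  · rw [if_neg h, mul_one, sq, ← mul_inv, ← Nat.cast_mul, ← Fintype.card_prod]
    rw [← inv_card_mul_sum_ite_eq _ (affineEval_prod_surjective (m := Fin (d i)) h) (b i, b i)]
    simp only [Prod.ext_iff]
    rfl

/-- The excess collision weight of two message tuples under random affine binning. -/
def collisionExcess {N : Fin t → Type*} [∀ i, Fintype (N i)] (d : Fin t → ℕ)
    (x x' : ∀ i, N i → F) : ℝ :=
  ∑ S : Finset (Fin t) with S.Nonempty,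
    if ∀ i ∈ S, x' i = x i then ∏ i ∈ S, (Fintype.card (Fin (d i) → F) : ℝ) else 0

theorem collisionExcess_nonneg {N : Fin t → Type*} [∀ i, Fintype (N i)] (d : Fin t → ℕ)
    (x x' : ∀ i, N i → F) : 0 ≤ collisionExcess d x x' :=
  Finset.sum_nonneg fun S _ => by split_ifs <;> positivity

theorem prod_card_le_one_add_collisionExcess {N : Fin t → Type*} [∀ i, Fintype (N i)]
    (d : Fin t → ℕ) (x x' : ∀ i, N i → F) :
    ∏ i with x i = x' i, (Fintype.card (Fin (d i) → F) : ℝ) ≤ 1 + collisionExcess d x x' := by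
  rcases Finset.eq_empty_or_nonempty ({i | x i = x' i} : Finset (Fin t)) with h | h
  · rw [h, Finset.prod_empty]
    linarith [collisionExcess_nonneg d x x']
  · have := Finset.single_le_sum (f := fun S : Finset (Fin t) =>
      if ∀ i ∈ S, x' i = x i then ∏ i ∈ S, (Fintype.card (Fin (d i) → F) : ℝ) else 0)
      (fun S _ => by split_ifs <;> positivity)
      (Finset.mem_filter.2 ⟨Finset.mem_univ _, h⟩)
    rw [if_pos fun i hi => (Finset.mem_filter.1 hi).2.symm] at this
    rw [collisionExcess]
    linarith

/-- The probability of a product event under an i.i.d. law. -/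
theorem sum_ite_forall_prod {Ω : Type*} [Fintype Ω] {n : ℕ} (p : Ω → ℝ)
    (P : Fin n → Ω → Prop) [∀ j, DecidablePred (P j)] :
    (∑ ω : Fin n → Ω, if ∀ j, P j (ω j) then ∏ j, p (ω j) else 0) =
      ∏ j, ∑ x, if P j x then p x else 0 := by
  rw [Fintype.prod_sum]
  refine Finset.sum_congr rfl fun ω _ => ?_
  split_ifs with h
  · exact Finset.prod_congr rfl fun j _ => (if_pos (h j)).symm
  · push Not at h
    obtain ⟨j, hj⟩ := h
    exact (Finset.prod_eq_zero (Finset.mem_univ j) (if_neg hj)).symm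

theorem pC_eq_sum_ite (p : ((∀ i, Fin (ℓ i) → F) × C) → ℝ) (c : C) :
    pC p c = ∑ x, if x.2 = c then p x else 0 := by
  rw [pC, Fintype.sum_prod_type]
  simp

theorem pSC_eq_sum_ite (p : ((∀ i, Fin (ℓ i) → F) × C) → ℝ) (S : Finset (Fin t))
    (m : ∀ i, Fin (ℓ i) → F) (c : C) :
    pSC p S (fun i => m i.1) c =
      ∑ x, if x.2 = c ∧ ∀ i ∈ S, x.1 i = m i then p x else 0 := by
  rw [pSC, Fintype.sum_prod_type]
  refine Finset.sum_congr rfl fun m' _ => ?_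
  simp [ite_and]

theorem condEnt_eq (p : ((∀ i, Fin (ℓ i) → F) × C) → ℝ) (S : Finset (Fin t)) :
    condEnt p S =
      -∑ x, p x * Real.logb 2 (pSC p S (fun i => x.1 i.1) x.2 / pC p x.2) := by
  rw [condEnt, Fintype.sum_prod_type, Finset.sum_comm]
  conv_rhs => rw [Finset.sum_comm]
  congr 1
  refine Finset.sum_congr rfl fun c _ => ?_
  simp_rw [pSC, Finset.sum_mul]
  rw [Finset.sum_comm]
  refine Finset.sum_congr rfl fun m _ => ?_
  rw [Finset.sum_eq_single fun i : S => m i.1]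
  · simp
  · intro f _ hf
    rw [if_neg, zero_mul]
    exact fun h => hf (funext fun i => (h i).symm)
  · simp

theorem prod_pC_eq {n : ℕ} (p : ((∀ i, Fin (ℓ i) → F) × C) → ℝ) (c : Fin n → C) :
    ∏ j, pC p (c j) = ∑ ω : Fin n → (∀ i, Fin (ℓ i) → F) × C,
      if (fun j => (ω j).2) = c then ∏ j, p (ω j) else 0 := by
  simp_rw [funext_iff, pC_eq_sum_ite]
  exact (sum_ite_forall_prod p fun j x => x.2 = c j).symm

theorem prod_pSC_eq {n : ℕ} (p : ((∀ i, Fin (ℓ i) → F) × C) → ℝ) (S : Finset (Fin t))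
    (ω : Fin n → (∀ i, Fin (ℓ i) → F) × C) :
    ∏ j, pSC p S (fun i => (ω j).1 i.1) (ω j).2 =
      ∑ ω' : Fin n → (∀ i, Fin (ℓ i) → F) × C,
        if (fun j => (ω' j).2) = (fun j => (ω j).2) ∧
          ∀ i ∈ S, (fun q : Fin n × Fin (ℓ i) => (ω' q.1).1 i q.2) = fun q => (ω q.1).1 i q.2
        then ∏ j, p (ω' j) else 0 := by
  simp_rw [pSC_eq_sum_ite]
  rw [← sum_ite_forall_prod p fun j x => x.2 = (ω j).2 ∧ ∀ i ∈ S, x.1 i = (ω j).1 i]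
  refine Finset.sum_congr rfl fun ω' _ => if_congr ?_ rfl rfl
  simp only [funext_iff, Prod.forall, forall_and]
  exact and_congr_right fun _ => ⟨fun h i hi j => h j i hi, fun h j i hi => h i hi j⟩

/-- One-shot bound on the expected total variation distance in terms of the sizes of the bins and
the probabilities of atypically likely messages. -/
theorem EbinL_le (p : ((∀ i, Fin (ℓ i) → F) × C) → ℝ)
    (hp0 : ∀ x, 0 ≤ p x) (hp1 : ∑ x, p x = 1) (R : Fin t → ℝ) (n : ℕ)
    (a : Finset (Fin t) → ℝ) :
    EbinL p R n ≤
      2⁻¹ * √(∑ S : Finset (Fin t) with S.Nonempty,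
        (∏ i ∈ S, (Fintype.card (Fin (nb (Fintype.card F) R n i) → F) : ℝ)) *
          Real.exp (-a S) ^ n) +
      ∑ S : Finset (Fin t) with S.Nonempty, ∑ ω : Fin n → (∀ i, Fin (ℓ i) → F) × C,
        if Real.exp (-a S) ^ n * ∏ j, pC p (ω j).2 <
          ∏ j, pSC p S (fun i => (ω j).1 i.1) (ω j).2
        then ∏ j, p (ω j) else 0 := by
  classical
  set d := nb (Fintype.card F) R n with hd
  let w : (Fin n → (∀ i, Fin (ℓ i) → F) × C) → ℝ := fun ω => ∏ j, p (ω j)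
  let X : (Fin n → (∀ i, Fin (ℓ i) → F) × C) → ∀ i, Fin n × Fin (ℓ i) → F :=
    fun ω i q => (ω q.1).1 i q.2
  let T : (Fin n → (∀ i, Fin (ℓ i) → F) × C) → Prop := fun ω =>
    ∀ S : Finset (Fin t), S.Nonempty → ∏ j, pSC p S (fun i => (ω j).1 i.1) (ω j).2 ≤
      Real.exp (-a S) ^ n * ∏ j, pC p (ω j).2
  have hw0 : ∀ ω, 0 ≤ w ω := fun ω => Finset.prod_nonneg fun j _ => hp0 _
  have hw1 : ∑ ω, w ω = 1 := by
    simp only [w]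
    rw [← Fintype.sum_pow, hp1, one_pow]
  have key := expected_tv_le w hw0 hw1 (fun ω j => (ω j).2)
    (fun (k : ∀ i, Matrix (Fin (d i)) (Fin n × Fin (ℓ i)) F × (Fin (d i) → F)) ω i =>
      (k i).1.mulVec (X ω i) + (k i).2) T
    (fun ω ω' => collisionExcess d (X ω) (X ω')) (fun ω ω' => collisionExcess_nonneg _ _ _)
    (∑ S : Finset (Fin t) with S.Nonempty,
        (∏ i ∈ S, (Fintype.card (Fin (d i) → F) : ℝ)) * Real.exp (-a S) ^ n)
    (by positivity) (fun ω b => affine_bins_uniform d (X ω) b)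
    (fun ω ω' b => by
      refine (affine_bins_collision d (X ω) (X ω') b).trans_le ?_
      exact mul_le_mul_of_nonneg_left (prod_card_le_one_add_collisionExcess d _ _)
        (by positivity))
    (fun ω hω => by
      rw [← prod_pC_eq, Finset.sum_mul]
      have e : ∀ ω' : Fin n → (∀ i, Fin (ℓ i) → F) × C,
          (if (fun j => (ω' j).2) = (fun j => (ω j).2) then
            w ω' * collisionExcess d (X ω) (X ω') else 0) =
          ∑ S : Finset (Fin t) with S.Nonempty,
            (∏ i ∈ S, (Fintype.card (Fin (d i) → F) : ℝ)) *
            if (fun j => (ω' j).2) = (fun j => (ω j).2) ∧ ∀ i ∈ S, X ω' i = X ω i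
            then w ω' else 0 := fun ω' => by
        by_cases h : (fun j => (ω' j).2) = (fun j => (ω j).2)
        · simp only [h, if_true, true_and, collisionExcess, Finset.mul_sum]
          refine Finset.sum_congr rfl fun S _ => ?_
          split_ifs <;> ring
        · simp [h]
      simp_rw [e]
      rw [Finset.sum_comm]
      refine Finset.sum_le_sum fun S hS => ?_
      rw [← Finset.mul_sum, ← prod_pSC_eq p S ω, mul_assoc]
      exact mul_le_mul_of_nonneg_left (hω S (Finset.mem_filter.1 hS).2) (by positivity))
  refine le_trans (le_of_eq ?_) (key.trans (add_le_add_right ?_ _))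
  · unfold EbinL
    refine congrArg _ (Finset.sum_congr rfl fun k _ => congrArg _
      (Finset.sum_congr rfl fun c _ => Finset.sum_congr rfl fun b _ =>
        congrArg _ (congrArg₂ _ ?_ ?_)))
    · refine Finset.sum_congr rfl fun ω _ => if_congr ?_ rfl rfl
      exact and_congr funext_iff.symm funext_iff.symm
    · rw [QidealL, prod_pC_eq, Finset.prod_inv_distrib, Fintype.card_pi, Nat.cast_prod]
  · rw [Finset.sum_comm]
    refine Finset.sum_le_sum fun ω _ => ?_
    split_ifs with h
    · exact Finset.sum_nonneg fun S _ => by split_ifs <;> simp [Finset.prod_nonneg, hp0]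
    · simp only [T] at h
      push Not at h
      obtain ⟨S, hS, hlt⟩ := h
      have := Finset.single_le_sum (f := fun S : Finset (Fin t) =>
        if Real.exp (-a S) ^ n * ∏ j, pC p (ω j).2 <
          ∏ j, pSC p S (fun i => (ω j).1 i.1) (ω j).2 then ∏ j, p (ω j) else 0)
        (fun S _ => by split_ifs <;> simp [Finset.prod_nonneg, hp0])
        (Finset.mem_filter.2 ⟨Finset.mem_univ _, hS⟩)
      rwa [if_pos hlt] at this

/-- The number of bins at rate `R i` is at most `2 ^ (n * R i)`. -/
theorem card_bin_le (R : Fin t → ℝ) (hR : ∀ i, 0 < R i) (n : ℕ) (i : Fin t) :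
    (Fintype.card (Fin (nb (Fintype.card F) R n i) → F) : ℝ) ≤
      Real.exp (R i * Real.log 2) ^ n := by
  have hq : (1 : ℝ) < Fintype.card F := by exact_mod_cast Fintype.one_lt_card
  have hlq : 0 < Real.log (Fintype.card F) := Real.log_pos hq
  have hl2 : 0 < Real.log 2 := Real.log_pos one_lt_two
  have hfl : (nb (Fintype.card F) R n i : ℝ) ≤ n * R i / Real.logb 2 (Fintype.card F) :=
    Nat.floor_le (div_nonneg (mul_nonneg n.cast_nonneg (hR i).le)
      (Real.logb_nonneg one_lt_two hq.le))
  rw [Fintype.card_fun, Fintype.card_fin, Nat.cast_pow, ← Real.exp_nat_mul,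
    ← Real.exp_log (show (0 : ℝ) < (Fintype.card F : ℝ) ^ nb (Fintype.card F) R n i by positivity),
    Real.log_pow]
  refine Real.exp_le_exp.2 ?_
  calc (nb (Fintype.card F) R n i : ℝ) * Real.log (Fintype.card F)
      ≤ n * R i / Real.logb 2 (Fintype.card F) * Real.log (Fintype.card F) := by gcongr
    _ = n * (R i * Real.log 2) := by
      rw [Real.logb]
      field_simp

/-- Messages that are atypically likely given `C` have exponentially small probability. -/
theorem exists_pow_bound_atypical (p : ((∀ i, Fin (ℓ i) → F) × C) → ℝ)
    (hp0 : ∀ x, 0 ≤ p x) (hp1 : ∑ x, p x = 1) (S : Finset (Fin t)) (a : ℝ)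
    (ha : a < condEnt p S * Real.log 2) :
    ∃ ρ : ℝ, 0 ≤ ρ ∧ ρ < 1 ∧ ∀ n : ℕ, (∑ ω : Fin n → (∀ i, Fin (ℓ i) → F) × C,
        if Real.exp (-a) ^ n * ∏ j, pC p (ω j).2 <
          ∏ j, pSC p S (fun i => (ω j).1 i.1) (ω j).2
        then ∏ j, p (ω j) else 0) ≤ ρ ^ n := by
  let u : (∀ i, Fin (ℓ i) → F) × C → ℝ := fun x => pSC p S (fun i => x.1 i.1) x.2
  let v : (∀ i, Fin (ℓ i) → F) × C → ℝ := fun x => pC p x.2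
  have hu : ∀ x, 0 < p x → 0 < u x := fun x hx => by
    simp only [u]
    rw [pSC_eq_sum_ite]
    refine Finset.sum_pos' (fun y _ => ?_) ⟨x, Finset.mem_univ _, by simpa using hx⟩
    split_ifs <;> simp [hp0]
  have hv : ∀ x, 0 < p x → 0 < v x := fun x hx => by
    simp only [v]
    rw [pC_eq_sum_ite]
    refine Finset.sum_pos' (fun y _ => ?_) ⟨x, Finset.mem_univ _, by simpa using hx⟩
    split_ifs <;> simp [hp0]
  have hl2 : Real.log 2 ≠ 0 := (Real.log_pos one_lt_two).ne'
  have hmean : ∑ x, p x * (Real.log (u x / v x) + a) < 0 := by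
    have e : condEnt p S * Real.log 2 = -∑ x, p x * Real.log (u x / v x) := by
      rw [condEnt_eq, neg_mul, Finset.sum_mul]
      congr 1
      refine Finset.sum_congr rfl fun x _ => ?_
      rw [mul_assoc, Real.logb, div_mul_cancel₀ _ hl2]
    simp_rw [mul_add]
    rw [Finset.sum_add_distrib, ← Finset.sum_mul, hp1]
    linarith
  obtain ⟨s, hs, hlt⟩ := exists_pos_sum_mul_exp_lt_one p _ hp1 hmean
  exact ⟨_, Finset.sum_nonneg fun x _ => mul_nonneg (hp0 x) (Real.exp_pos _).le, hlt,
    fun n => sum_ite_prod_le_pow p u v hp0 hu hv a s hs n⟩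

/-- **Linear OSRB.** If `∑_{i∈S} Rᵢ < H(M_S | C)` for every nonempty
`S ⊆ [t]`, then the expected total variation distance between the pmf of
`(C([n]), M̄₁, …, M̄_t)` induced by uniformly random affine linear binnings and the
ideal pmf tends to `0` as `n → ∞`. -/
theorem linear_osrb (p : ((∀ i, Fin (ℓ i) → F) × C) → ℝ)
    (hp0 : ∀ x, 0 ≤ p x) (hp1 : ∑ x, p x = 1)
    (R : Fin t → ℝ) (hR : ∀ i, 0 < R i)
    (hrate : ∀ S : Finset (Fin t), S.Nonempty → ∑ i ∈ S, R i < condEnt p S) :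
    Filter.Tendsto (fun n => EbinL p R n) Filter.atTop (nhds 0) := by
  have hl2 : 0 < Real.log 2 := Real.log_pos one_lt_two
  have hex : ∀ S : Finset (Fin t), ∃ a : ℝ, S.Nonempty →
      (∑ i ∈ S, R i) * Real.log 2 < a ∧ a < condEnt p S * Real.log 2 := fun S => by
    by_cases hS : S.Nonempty
    · obtain ⟨a, ha⟩ := exists_between (mul_lt_mul_of_pos_right (hrate S hS) hl2)
      exact ⟨a, fun _ => ha⟩
    · exact ⟨0, fun h => absurd h hS⟩
  choose a ha using hex
  have hρex : ∀ S : Finset (Fin t), ∃ ρ : ℝ, S.Nonempty → 0 ≤ ρ ∧ ρ < 1 ∧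
      ∀ n : ℕ, (∑ ω : Fin n → (∀ i, Fin (ℓ i) → F) × C,
        if Real.exp (-a S) ^ n * ∏ j, pC p (ω j).2 <
          ∏ j, pSC p S (fun i => (ω j).1 i.1) (ω j).2
        then ∏ j, p (ω j) else 0) ≤ ρ ^ n := fun S => by
    by_cases hS : S.Nonempty
    · obtain ⟨ρ, hρ⟩ := exists_pow_bound_atypical p hp0 hp1 S (a S) (ha S hS).2
      exact ⟨ρ, fun _ => hρ⟩
    · exact ⟨0, fun h => absurd h hS⟩
  choose ρ hρ using hρex
  let τ : Finset (Fin t) → ℝ := fun S => Real.exp ((∑ i ∈ S, R i) * Real.log 2 - a S)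
  have hbound : ∀ n, EbinL p R n ≤
      2⁻¹ * √(∑ S : Finset (Fin t) with S.Nonempty, τ S ^ n) +
        ∑ S : Finset (Fin t) with S.Nonempty, ρ S ^ n := fun n => by
    refine (EbinL_le p hp0 hp1 R n a).trans (add_le_add ?_ ?_)
    · refine mul_le_mul_of_nonneg_left (Real.sqrt_le_sqrt (Finset.sum_le_sum fun S _ => ?_))
        (by norm_num)
      calc _ ≤ (∏ i ∈ S, Real.exp (R i * Real.log 2) ^ n) * Real.exp (-a S) ^ n := by
            gcongr with i
            exact card_bin_le R hR n i
        _ = τ S ^ n := by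
            rw [Finset.prod_pow, ← Real.exp_sum, ← Finset.sum_mul, ← mul_pow, ← Real.exp_add,
              ← sub_eq_add_neg]
    · exact Finset.sum_le_sum fun S hS => (hρ S (Finset.mem_filter.1 hS).2).2.2 n
  have hτ0 : Filter.Tendsto (fun n : ℕ => ∑ S : Finset (Fin t) with S.Nonempty, τ S ^ n)
      Filter.atTop (nhds 0) := by
    rw [← Finset.sum_const_zero (ι := Finset (Fin t)) (s := univ.filter Finset.Nonempty)]
    refine tendsto_finsetSum _ fun S hS => tendsto_pow_atTop_nhds_zero_of_lt_one
      (Real.exp_pos _).le (Real.exp_lt_one_iff.2 ?_)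
    linarith [(ha S (Finset.mem_filter.1 hS).2).1]
  have hρ0 : Filter.Tendsto (fun n : ℕ => ∑ S : Finset (Fin t) with S.Nonempty, ρ S ^ n)
      Filter.atTop (nhds 0) := by
    rw [← Finset.sum_const_zero (ι := Finset (Fin t)) (s := univ.filter Finset.Nonempty)]
    refine tendsto_finsetSum _ fun S hS => ?_
    have h := hρ S (Finset.mem_filter.1 hS).2
    exact tendsto_pow_atTop_nhds_zero_of_lt_one h.1 h.2.1
  refine squeeze_zero (fun n => ?_) hbound ?_
  · unfold EbinL
    positivity
  · simpa using (hτ0.sqrt.const_mul 2⁻¹).add hρ0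

end LinOSRB
end
end
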